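/- arXiv:2212.12511 — 8 statements merged into one kernel-verified Lean document; each statement's English description precedes it below -/
import Mathlib

section
/- Let f be a continuous real-valued function on a closed interval I ⊆ ℝ. Then d_f is a pseudometric on I: d_f(s,t) ≥ 0, d_f(s,s) = 0, d_f(s,t) = d_f(t,s), and d_f(s,u) ≤ d_f(s,t) + d_f(t,u) for all s, t, u ∈ I. Moreover, d_f(s,t) ≤ 2·ω(f;[s∧t, s∨t]) for all s, t ∈ I. -/
/-- The tree pseudometric `d_f(s,t) = f(s) + f(t) − 2·inf{f(u) : s∧t ≤ u ≤ s∨t}`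
coded by a function `f : ℝ → ℝ`. -/
noncomputable def dOf (f : ℝ → ℝ) (s t : ℝ) : ℝ :=
  f s + f t - 2 * sInf (f '' Set.Icc (min s t) (max s t))

/-- The modulus `ω(f;J) = sup_J f − inf_J f` of `f` on a set `J`. -/
noncomputable def osc (f : ℝ → ℝ) (J : Set ℝ) : ℝ :=
  sSup (f '' J) - sInf (f '' J)

open Set in
/-- Values of a function continuous on an order-connected set are bounded below by the infimum
over the interval joining two points of the set. -/
theorem ContinuousOn.sInf_image_Icc_min_max_le {I : Set ℝ} (hI : I.OrdConnected) {f : ℝ → ℝ}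
    (hf : ContinuousOn f I) {s t x : ℝ} (hs : s ∈ I) (ht : t ∈ I)
    (hx : x ∈ Icc (min s t) (max s t)) : sInf (f '' Icc (min s t) (max s t)) ≤ f x :=
  csInf_le (isCompact_Icc.image_of_continuousOn (hf.mono (hI.uIcc_subset hs ht))).bddBelow
    (mem_image_of_mem f hx)

open Set in
/-- Values of a function continuous on an order-connected set are bounded above by the supremum
over the interval joining two points of the set. -/
theorem ContinuousOn.le_sSup_image_Icc_min_max {I : Set ℝ} (hI : I.OrdConnected) {f : ℝ → ℝ}
    (hf : ContinuousOn f I) {s t x : ℝ} (hs : s ∈ I) (ht : t ∈ I)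
    (hx : x ∈ Icc (min s t) (max s t)) : f x ≤ sSup (f '' Icc (min s t) (max s t)) :=
  le_csSup (isCompact_Icc.image_of_continuousOn (hf.mono (hI.uIcc_subset hs ht))).bddAbove
    (mem_image_of_mem f hx)

/-- for `f` continuous on a closed interval `I ⊆ ℝ`, `d_f` is a pseudometric
on `I`, and `d_f(s,t) ≤ 2·ω(f;[s∧t, s∨t])`. -/
theorem dOf_pseudometric
    (I : Set ℝ) (hIclosed : IsClosed I) (hIconn : I.OrdConnected)
    (f : ℝ → ℝ) (hf : ContinuousOn f I) :
    (∀ s ∈ I, ∀ t ∈ I, 0 ≤ dOf f s t) ∧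
    (∀ s ∈ I, dOf f s s = 0) ∧
    (∀ s ∈ I, ∀ t ∈ I, dOf f s t = dOf f t s) ∧
    (∀ s ∈ I, ∀ t ∈ I, ∀ u ∈ I, dOf f s u ≤ dOf f s t + dOf f t u) ∧
    (∀ s ∈ I, ∀ t ∈ I, dOf f s t ≤ 2 * osc f (Set.Icc (min s t) (max s t))) := by
  have left_mem (s t : ℝ) : s ∈ Set.Icc (min s t) (max s t) := Set.left_mem_uIcc
  have right_mem (s t : ℝ) : t ∈ Set.Icc (min s t) (max s t) := Set.right_mem_uIcc
  refine ⟨fun s hs t ht ↦ ?_, fun s _ ↦ ?_, fun s _ t _ ↦ ?_, fun s hs t ht u hu ↦ ?_,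
    fun s hs t ht ↦ ?_⟩
  · have h₁ := hf.sInf_image_Icc_min_max_le hIconn hs ht (left_mem s t)
    have h₂ := hf.sInf_image_Icc_min_max_le hIconn hs ht (right_mem s t)
    unfold dOf
    linarith
  · simp only [dOf, min_self, max_self, Set.Icc_self, Set.image_singleton, csInf_singleton]
    ring
  · simp only [dOf, min_comm s t, max_comm s t, add_comm (f s)]
  · obtain ⟨v, hv, hv_eq⟩ := (isCompact_Icc.image_of_continuousOn
      (hf.mono (hIconn.uIcc_subset hs hu))).sInf_mem ⟨f s, s, left_mem s u, rfl⟩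
    have hst := hf.sInf_image_Icc_min_max_le hIconn hs ht (right_mem s t)
    have htu := hf.sInf_image_Icc_min_max_le hIconn ht hu (left_mem t u)
    unfold dOf
    rcases Set.uIcc_subset_uIcc_union_uIcc (b := t) hv with h | h
    · have hv_le := hf.sInf_image_Icc_min_max_le hIconn hs ht h
      linarith
    · have hv_le := hf.sInf_image_Icc_min_max_le hIconn ht hu h
      linarith
  · have h₁ := hf.le_sSup_image_Icc_min_max hIconn hs ht (left_mem s t)
    have h₂ := hf.le_sSup_image_Icc_min_max hIconn hs ht (right_mem s t)
    unfold dOf osc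
    linarith
end

section
/- Let d be an extended pseudometric on a set M and let R₁, R₂ be equivalence relations on M. Then (d/R₁)/R₂ = (d/R₂)/R₁ = d/R, where R is the coarsest equivalence relation on M containing R₁ ∪ R₂. -/
open scoped ENNReal

/-- The quotient pseudometric `d/R` of an extended pseudometric `d` by a relation `R`:
`(d/R)(x,y) = inf{ Σ d(xᵢ,yᵢ) : x₁ = x, y_m = y, yᵢ R xᵢ₊₁ }`. -/
noncomputable def quotDist {M : Type*} (d : M → M → ℝ≥0∞) (R : M → M → Prop)
    (x y : M) : ℝ≥0∞ :=
  ⨅ (n : ℕ) (a : Fin (n + 1) → M) (b : Fin (n + 1) → M)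
    (_ : a 0 = x) (_ : b (Fin.last n) = y)
    (_ : ∀ i : Fin n, R (b i.castSucc) (a i.succ)),
    ∑ i, d (a i) (b i)

section quotDist

variable {M : Type*} {d e : M → M → ℝ≥0∞} {R : M → M → Prop}

theorem quotDist_le_sum (d : M → M → ℝ≥0∞) {n : ℕ} {a b : Fin (n + 1) → M}
    (h : ∀ i : Fin n, R (b i.castSucc) (a i.succ)) :
    quotDist d R (a 0) (b (Fin.last n)) ≤ ∑ i, d (a i) (b i) :=
  iInf_le_of_le n <| iInf_le_of_le a <| iInf_le_of_le b <| iInf_le_of_le rfl <|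
    iInf_le_of_le rfl <| iInf_le_of_le h le_rfl

theorem le_quotDist {x y : M} {c : ℝ≥0∞}
    (h : ∀ (n : ℕ) (a b : Fin (n + 1) → M), a 0 = x → b (Fin.last n) = y →
      (∀ i : Fin n, R (b i.castSucc) (a i.succ)) → c ≤ ∑ i, d (a i) (b i)) :
    c ≤ quotDist d R x y :=
  le_iInf fun n => le_iInf fun a => le_iInf fun b => le_iInf fun ha => le_iInf fun hb =>
    le_iInf fun hR => h n a b ha hb hR

theorem quotDist_le (d : M → M → ℝ≥0∞) (R : M → M → Prop) (x y : M) :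
    quotDist d R x y ≤ d x y := by
  simpa using quotDist_le_sum (R := R) d (n := 0) (a := fun _ => x) (b := fun _ => y)
    (fun i => i.elim0)

/-- Prepending a pair to a chain. -/
theorem quotDist_le_add_of_rel {x y w z : M} (h : R y w) :
    quotDist d R x z ≤ d x y + quotDist d R w z := by
  rw [← tsub_le_iff_left]
  refine le_quotDist fun n a b ha hb hR => ?_
  subst ha hb
  rw [tsub_le_iff_left]
  have key := quotDist_le_sum (R := R) d (n := n + 1) (a := Fin.cons x a) (b := Fin.cons y b)
    (Fin.cases (by simpa using h) fun i => by simpa [← Fin.succ_castSucc] using hR i)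
  simpa [Fin.sum_univ_succ (n := n + 1), ← Fin.succ_last] using key

/-- A function that grows by at most `d` along links, and not at all along jumps, grows by at most
the chain sum. -/
theorem le_sum_add_of_le_add {g : M → ℝ≥0∞}
    (h₁ : ∀ x y, g x ≤ d x y + g y) (h₂ : ∀ x y, R x y → g x ≤ g y) {n : ℕ}
    {a b : Fin (n + 1) → M} (h : ∀ i : Fin n, R (b i.castSucc) (a i.succ)) :
    g (a 0) ≤ ∑ i, d (a i) (b i) + g (b (Fin.last n)) := by
  induction n with
  | zero => simpa using h₁ (a 0) (b 0)
  | succ n ih =>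
    have key := ih (a := fun i => a i.succ) (b := fun i => b i.succ) fun i => h i.succ
    rw [Fin.sum_univ_succ, add_assoc (d (a 0) (b 0))]
    calc g (a 0) ≤ d (a 0) (b 0) + g (b 0) := h₁ _ _
      _ ≤ d (a 0) (b 0) + g (a 1) := by gcongr; exact h₂ _ _ (h 0)
      _ ≤ _ := by gcongr; exact key

theorem quotDist_triangle (hd : ∀ x, d x x = 0) (hR : ∀ x, R x x) (x y z : M) :
    quotDist d R x z ≤ quotDist d R x y + quotDist d R y z := by
  rw [← tsub_le_iff_right]
  refine le_quotDist fun n a b ha hb h => ?_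
  subst ha hb
  rw [tsub_le_iff_right]
  exact le_sum_add_of_le_add (R := R) (g := fun w => quotDist d R w z)
    (fun u v => quotDist_le_add_of_rel (hR v)) (fun u v huv => by
      simpa [hd] using quotDist_le_add_of_rel (d := d) (x := u) (z := z) huv) h

theorem quotDist_eq_zero_of_rel (hd : ∀ x, d x x = 0) {x y : M} (h : R x y) :
    quotDist d R x y = 0 := by
  refine le_antisymm ?_ zero_le
  simpa [hd] using (quotDist_le_add_of_rel (d := d) (x := x) (z := y) h).trans
    (add_le_add_right (quotDist_le d R y y) _)

/-- `d/R` is the greatest function below `d` that satisfies the triangle inequality and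
vanishes on `R`. -/
theorem le_quotDist_of_le (hed : ∀ x y, e x y ≤ d x y)
    (he : ∀ x y z, e x z ≤ e x y + e y z) (hR : ∀ x y, R x y → e x y = 0)
    (he₀ : ∀ x, e x x = 0) (x y : M) : e x y ≤ quotDist d R x y := by
  refine le_quotDist fun n a b ha hb h => ?_
  subst ha hb
  simpa [he₀] using le_sum_add_of_le_add (d := d) (R := R)
    (g := fun w => e w (b (Fin.last n)))
    (fun u v => (he u v _).trans (by gcongr; exact hed u v))
    (fun u v huv => (he u v _).trans (by simp [hR u v huv])) h

/-- `(d/R₁)/R₂ = d/R` if `R` is the coarsest equivalence relation containing `R₁` and `R₂`. -/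
theorem quotDist_quotDist (hd : ∀ x, d x x = 0) {R₁ R₂ : M → M → Prop}
    (hR₁ : Equivalence R₁) (hR₂ : Equivalence R₂) (hR : Equivalence R)
    (hR₁R : ∀ x y, R₁ x y → R x y) (hR₂R : ∀ x y, R₂ x y → R x y)
    (hRmin : ∀ S : M → M → Prop, Equivalence S → (∀ x y, R₁ x y → S x y) →
      (∀ x y, R₂ x y → S x y) → ∀ x y, R x y → S x y) (x y : M) :
    quotDist (quotDist d R₁) R₂ x y = quotDist d R x y := by
  have hd₁ : ∀ x, quotDist d R₁ x x = 0 := fun x => quotDist_eq_zero_of_rel hd (hR₁.refl x)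
  have hd₂ : ∀ x, quotDist (quotDist d R₁) R₂ x x = 0 := fun x =>
    quotDist_eq_zero_of_rel hd₁ (hR₂.refl x)
  have hd₃ : ∀ x y, R x y → quotDist d R x y = 0 := fun _ _ => quotDist_eq_zero_of_rel hd
  have tri := quotDist_triangle hd₁ hR₂.refl
  have hv₁ : ∀ x y, R₁ x y → quotDist (quotDist d R₁) R₂ x y = 0 := fun x y h =>
    le_antisymm ((quotDist_le _ _ x y).trans (quotDist_eq_zero_of_rel hd h).le) zero_le
  have hv₂ : ∀ x y, R₂ x y → quotDist (quotDist d R₁) R₂ x y = 0 := fun _ _ =>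
    quotDist_eq_zero_of_rel hd₁
  have zero_trans : ∀ {x y z}, quotDist (quotDist d R₁) R₂ x y = 0 →
      quotDist (quotDist d R₁) R₂ y z = 0 → quotDist (quotDist d R₁) R₂ x z = 0 :=
    fun {x y z} h h' => le_antisymm ((tri x y z).trans (by simp [h, h'])) zero_le
  apply le_antisymm
  · refine le_quotDist_of_le (fun x y => (quotDist_le _ _ x y).trans (quotDist_le _ _ x y)) tri
      (fun x y h => ?_) hd₂ x y
    exact (hRmin (fun x y => quotDist (quotDist d R₁) R₂ x y = 0 ∧
        quotDist (quotDist d R₁) R₂ y x = 0)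
      ⟨fun x => ⟨hd₂ x, hd₂ x⟩, And.symm,
        fun h h' => ⟨zero_trans h.1 h'.1, zero_trans h'.2 h.2⟩⟩
      (fun x y h => ⟨hv₁ x y h, hv₁ y x (hR₁.symm h)⟩)
      (fun x y h => ⟨hv₂ x y h, hv₂ y x (hR₂.symm h)⟩) x y h).1
  · have tri' := quotDist_triangle hd hR.refl
    have hd₄ : ∀ x, quotDist d R x x = 0 := fun x => hd₃ x x (hR.refl x)
    exact le_quotDist_of_le
      (le_quotDist_of_le (quotDist_le d R) tri' (fun x y h => hd₃ x y (hR₁R x y h)) hd₄)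
      tri' (fun x y h => hd₃ x y (hR₂R x y h)) hd₄ x y

end quotDist

/-- if `R₁, R₂` are equivalence relations and `R` is the coarsest equivalence
relation containing `R₁ ∪ R₂`, then `(d/R₁)/R₂ = (d/R₂)/R₁ = d/R`. -/
theorem quotDist_quotDist_comm {M : Type*} (d : M → M → ℝ≥0∞)
    (hd_symm : ∀ x y, d x y = d y x) (hd_refl : ∀ x, d x x = 0)
    (hd_triangle : ∀ x y z, d x z ≤ d x y + d y z)
    (R₁ R₂ R : M → M → Prop)
    (hR₁ : Equivalence R₁) (hR₂ : Equivalence R₂) (hR : Equivalence R)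
    (hR₁R : ∀ x y, R₁ x y → R x y) (hR₂R : ∀ x y, R₂ x y → R x y)
    (hRmin : ∀ S : M → M → Prop, Equivalence S → (∀ x y, R₁ x y → S x y) →
      (∀ x y, R₂ x y → S x y) → ∀ x y, R x y → S x y) :
    (∀ x y, quotDist (quotDist d R₁) R₂ x y = quotDist (quotDist d R₂) R₁ x y) ∧
    (∀ x y, quotDist (quotDist d R₁) R₂ x y = quotDist d R x y) := by
  have h₁₂ := quotDist_quotDist hd_refl hR₁ hR₂ hR hR₁R hR₂R hRmin
  have h₂₁ := quotDist_quotDist hd_refl hR₂ hR₁ hR hR₂R hR₁R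
    fun S hS h₂ h₁ => hRmin S hS h₁ h₂
  exact ⟨fun x y => (h₁₂ x y).trans (h₂₁ x y).symm, h₁₂⟩
end

section
/- Let X_n (n ∈ ℕ) and X be nonempty compact metric spaces. For each n, let x_n ∈ X_n and let B_n ⊆ X_n be the image of a geodesic of length ℓ_n with origin x_n (that is, B_n = χ_n([0,ℓ_n]) for some geodesic χ_n with χ_n(0) = x_n). Let A, B ⊆ X be nonempty compact subsets, and suppose that for each n there is a correspondence R_n between X_n and X such that R_n ∩ ({x_n} × A) is a correspondence between {x_n} and A, R_n ∩ (B_n × B) is a correspondence between B_n and B, and dis(R_n) → 0 as n → ∞. Then A is a singleton {x}, the sequence (ℓ_n) converges to some ℓ ≥ 0, and B is the image of a geodesic of length ℓ with origin x. -/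
open scoped ENNReal

/-- The distortion of a correspondence `R` between two metric spaces:
`dis(R) = sup{ |d(x,x') − d(y,y')| : (x,y), (x',y') ∈ R }`, valued in `[0,∞]`. -/
noncomputable def corrDis {α β : Type*} [PseudoMetricSpace α] [PseudoMetricSpace β]
    (R : Set (α × β)) : ℝ≥0∞ :=
  ⨆ p ∈ R, ⨆ q ∈ R, ENNReal.ofReal |dist p.1 q.1 - dist p.2 q.2|

/-- If the distortions tend to zero, then eventually all discrepancies are below a given bound. -/
theorem eventually_abs_dist_sub_le_of_tendsto_corrDis {Y : Type*} [PseudoMetricSpace Y]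
    {X : ℕ → Type*} [∀ n, PseudoMetricSpace (X n)] {R : ∀ n, Set (X n × Y)}
    (hdis : Filter.Tendsto (fun n => corrDis (R n)) Filter.atTop (nhds 0)) {δ : ℝ} (hδ : 0 < δ) :
    ∀ᶠ n in Filter.atTop, ∀ ξ y ξ' y', (ξ, y) ∈ R n → (ξ', y') ∈ R n →
      |dist ξ ξ' - dist y y'| ≤ δ := by
  filter_upwards [hdis.eventually_lt_const (ENNReal.ofReal_pos.2 hδ)] with n hn ξ y ξ' y' h h'
  have hle : ENNReal.ofReal |dist ξ ξ' - dist y y'| ≤ corrDis (R n) :=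
    (le_iSup₂_of_le (f := fun q (_ : q ∈ R n) => ENNReal.ofReal |dist ξ q.1 - dist y q.2|)
      (ξ', y') h' le_rfl).trans
    (le_iSup₂_of_le (f := fun p (_ : p ∈ R n) =>
      ⨆ q ∈ R n, ENNReal.ofReal |dist p.1 q.1 - dist p.2 q.2|) (ξ, y) h le_rfl)
  exact (ENNReal.ofReal_le_ofReal_iff hδ.le).1 (hle.trans hn.le)

/-- A set on which the distance to a point `x₀` is an isometry onto `[0, L]` is the image of a
geodesic with origin `x₀`. -/
theorem exists_geodesic_of_dist_eq_abs_sub {Y : Type*} [MetricSpace Y] {x₀ : Y} {B : Set Y}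
    {L : ℝ} (hL : 0 ≤ L)
    (hdist : ∀ y ∈ B, ∀ y' ∈ B, dist y y' = |dist x₀ y - dist x₀ y'|)
    (hle : ∀ y ∈ B, dist x₀ y ≤ L) (hsurj : ∀ t ∈ Set.Icc 0 L, ∃ y ∈ B, dist x₀ y = t) :
    ∃ χ : ℝ → Y, χ 0 = x₀ ∧
      (∀ s ∈ Set.Icc (0:ℝ) L, ∀ t ∈ Set.Icc (0:ℝ) L, dist (χ s) (χ t) = |s - t|) ∧
      B = χ '' Set.Icc (0:ℝ) L := by
  have hex : ∀ t, ∃ y, t ∈ Set.Icc 0 L → y ∈ B ∧ dist x₀ y = t := fun t => by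
    by_cases ht : t ∈ Set.Icc 0 L
    · obtain ⟨y, hy⟩ := hsurj t ht
      exact ⟨y, fun _ => hy⟩
    · exact ⟨x₀, fun h => absurd h ht⟩
  choose χ hχ using hex
  refine ⟨χ, (dist_eq_zero.1 (hχ 0 ⟨le_rfl, hL⟩).2).symm, fun s hs t ht => ?_, ?_⟩
  · rw [hdist _ (hχ s hs).1 _ (hχ t ht).1, (hχ s hs).2, (hχ t ht).2]
  · refine Set.Subset.antisymm (fun y hy => ?_) ?_
    · have hy' : dist x₀ y ∈ Set.Icc 0 L := ⟨dist_nonneg, hle y hy⟩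
      refine ⟨_, hy', dist_eq_zero.1 ?_⟩
      rw [hdist _ (hχ _ hy').1 _ hy, (hχ _ hy').2, sub_self, abs_zero]
    · rintro _ ⟨t, ht, rfl⟩
      exact (hχ t ht).1

/-- GH-limits of geodesic marks.  If correspondences `R n` compatible with the
marks `({xₙ}, Bₙ)` and `(A, B)` have vanishing distortion, and each `Bₙ` is the image of a
geodesic of length `ℓ n` with origin `xₙ`, then `A` is a singleton `{x}`, the lengths `ℓ n`
converge to some `L ≥ 0`, and `B` is the image of a geodesic of length `L` with origin `x`. -/
theorem geodesic_mark_limit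
    {Y : Type*} [MetricSpace Y] [CompactSpace Y] [Nonempty Y]
    (X : ℕ → Type*) [∀ n, MetricSpace (X n)] [∀ n, CompactSpace (X n)] [∀ n, Nonempty (X n)]
    (x : ∀ n, X n) (ℓ : ℕ → ℝ) (B' : ∀ n, Set (X n))
    (hB' : ∀ n, 0 ≤ ℓ n ∧ ∃ χ : ℝ → X n, χ 0 = x n ∧
      (∀ s ∈ Set.Icc (0:ℝ) (ℓ n), ∀ t ∈ Set.Icc (0:ℝ) (ℓ n),
        dist (χ s) (χ t) = |s - t|) ∧
      B' n = χ '' Set.Icc (0:ℝ) (ℓ n))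
    (A B : Set Y) (hAne : A.Nonempty) (hAc : IsCompact A)
    (hBne : B.Nonempty) (hBc : IsCompact B)
    (R : ∀ n, Set (X n × Y))
    (hcorr : ∀ n, (∀ ξ : X n, ∃ y : Y, (ξ, y) ∈ R n) ∧ (∀ y : Y, ∃ ξ : X n, (ξ, y) ∈ R n))
    (hmarkA : ∀ n, (∃ a ∈ A, (x n, a) ∈ R n) ∧ (∀ a ∈ A, (x n, a) ∈ R n))
    (hmarkB : ∀ n, (∀ b ∈ B' n, ∃ y ∈ B, (b, y) ∈ R n) ∧
      (∀ y ∈ B, ∃ b ∈ B' n, (b, y) ∈ R n))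
    (hdis : Filter.Tendsto (fun n => corrDis (R n)) Filter.atTop (nhds 0)) :
    ∃ x₀ : Y, A = {x₀} ∧ ∃ L : ℝ, 0 ≤ L ∧ Filter.Tendsto ℓ Filter.atTop (nhds L) ∧
      ∃ χ : ℝ → Y, χ 0 = x₀ ∧
        (∀ s ∈ Set.Icc (0:ℝ) L, ∀ t ∈ Set.Icc (0:ℝ) L, dist (χ s) (χ t) = |s - t|) ∧
        B = χ '' Set.Icc (0:ℝ) L := by
  have hev {δ : ℝ} (hδ : 0 < δ) := eventually_abs_dist_sub_le_of_tendsto_corrDis hdis hδ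
  obtain ⟨x₀, hx₀⟩ := hAne
  have hA : A = {x₀} := by
    refine Set.eq_singleton_iff_unique_mem.2 ⟨hx₀, fun a ha => dist_le_zero.1 ?_⟩
    refine le_of_forall_pos_le_add fun δ hδ => ?_
    obtain ⟨n, hn⟩ := (hev hδ).exists
    have h := hn _ _ _ _ ((hmarkA n).2 a ha) ((hmarkA n).2 x₀ hx₀)
    rw [dist_self, abs_le] at h
    linarith
  have hx₀R : ∀ n, (x n, x₀) ∈ R n := fun n => (hmarkA n).2 x₀ hx₀
  have hℓ : ∀ n, 0 ≤ ℓ n := fun n => (hB' n).1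
  choose χ hχ0 hχ hχB using fun n => (hB' n).2
  have hχx : ∀ n, ∀ s ∈ Set.Icc 0 (ℓ n), dist (x n) (χ n s) = s := fun n s hs => by
    rw [← hχ0, hχ n 0 ⟨le_rfl, hℓ n⟩ s hs, zero_sub, abs_neg, abs_of_nonneg hs.1]
  have hto : ∀ n, ∀ s ∈ Set.Icc 0 (ℓ n), ∃ y ∈ B, (χ n s, y) ∈ R n := fun n s hs =>
    (hmarkB n).1 _ (hχB n ▸ Set.mem_image_of_mem _ hs)
  have hfrom : ∀ n, ∀ y ∈ B, ∃ s ∈ Set.Icc 0 (ℓ n), (χ n s, y) ∈ R n := fun n y hy => by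
    obtain ⟨b, hb, hbR⟩ := (hmarkB n).2 y hy
    rw [hχB] at hb
    obtain ⟨s, hs, rfl⟩ := hb
    exact ⟨s, hs, hbR⟩
  have hdist : ∀ y ∈ B, ∀ y' ∈ B, dist y y' = |dist x₀ y - dist x₀ y'| := fun y hy y' hy' => by
    refine eq_of_abs_sub_nonpos (le_of_forall_pos_le_add fun δ hδ => ?_)
    obtain ⟨n, hn⟩ := (hev (δ := δ / 3) (by positivity)).exists
    obtain ⟨s, hs, hsR⟩ := hfrom n y hy
    obtain ⟨t, ht, htR⟩ := hfrom n y' hy'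
    have h₁ := hn _ _ _ _ hsR htR
    have h₂ := hn _ _ _ _ (hx₀R n) hsR
    have h₃ := hn _ _ _ _ (hx₀R n) htR
    rw [hχ n s hs t ht] at h₁
    rw [hχx n s hs] at h₂
    rw [hχx n t ht] at h₃
    have h₄ := abs_abs_sub_abs_le_abs_sub (s - t) (dist x₀ y - dist x₀ y')
    have h₅ : |s - t - (dist x₀ y - dist x₀ y')| ≤ δ / 3 + δ / 3 := by
      rw [abs_le] at *
      constructor <;> linarith
    have h₆ := h₄.trans h₅
    rw [abs_le] at h₁ h₆ ⊢
    constructor <;> linarith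
  have hcont : Continuous fun y => dist x₀ y := continuous_const.dist continuous_id
  obtain ⟨z, hz, hmax⟩ := hBc.exists_isMaxOn hBne hcont.continuousOn
  have hle : ∀ y ∈ B, dist x₀ y ≤ dist x₀ z := fun y hy => hmax hy
  have hclose : ∀ δ > 0, ∀ᶠ n in Filter.atTop, |ℓ n - dist x₀ z| ≤ δ := fun δ hδ => by
    filter_upwards [hev hδ] with n hn
    obtain ⟨s, hs, hsR⟩ := hfrom n z hz
    have hmem : ℓ n ∈ Set.Icc 0 (ℓ n) := ⟨hℓ n, le_rfl⟩
    obtain ⟨y, hy, hyR⟩ := hto n _ hmem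
    have h₁ := hn _ _ _ _ (hx₀R n) hsR
    have h₂ := hn _ _ _ _ (hx₀R n) hyR
    rw [hχx n s hs] at h₁
    rw [hχx n _ hmem] at h₂
    rw [abs_le] at *
    constructor <;> linarith [hle y hy, hs.2]
  refine ⟨x₀, hA, dist x₀ z, dist_nonneg, ?_,
    exists_geodesic_of_dist_eq_abs_sub dist_nonneg hdist hle fun t ht => ?_⟩
  · refine Metric.tendsto_nhds.2 fun δ hδ => ?_
    filter_upwards [hclose (δ / 2) (by positivity)] with n hn
    rw [Real.dist_eq]
    linarith
  · have hclosed : IsClosed ((fun y => dist x₀ y) '' B) := (hBc.image hcont).isClosed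
    change t ∈ (fun y => dist x₀ y) '' B
    refine hclosed.closure_subset (Metric.mem_closure_iff.2 fun δ hδ => ?_)
    obtain ⟨n, hn, hn'⟩ := ((hev (δ := δ / 3) (by positivity)).and
      (hclose (δ / 3) (by positivity))).exists
    have hmem : min t (ℓ n) ∈ Set.Icc 0 (ℓ n) := ⟨le_min ht.1 (hℓ n), min_le_right _ _⟩
    obtain ⟨y, hy, hyR⟩ := hto n _ hmem
    refine ⟨_, ⟨y, hy, rfl⟩, ?_⟩
    have h := hn _ _ _ _ (hx₀R n) hyR
    rw [hχx n _ hmem] at h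
    rw [Real.dist_eq, abs_lt]
    rw [abs_le] at h hn'
    have ht₂ := ht.2
    rcases min_cases t (ℓ n) with ⟨h₁, h₂⟩ | ⟨h₁, h₂⟩ <;> rw [h₁] at h <;>
      constructor <;> linarith
end

section
/- Let X and Y be metric spaces, let γ : [0,ℓ] → X and δ : [0,m] → Y be geodesics, and let R be a correspondence between X and Y such that (γ(0),δ(0)) ∈ R and R ∩ (γ([0,ℓ]) × δ([0,m])) is a correspondence between γ([0,ℓ]) and δ([0,m]). For ε > 0 let R^ε = {(x,y) ∈ X × Y : there exists (x',y') ∈ R with d_X(x,x') < ε and d_Y(y,y') < ε}. Fix r ∈ (0,ℓ) and r' ∈ (0,m), and suppose ε > dis(R) + max(|r − r'|, |ℓ − m|). Then R^ε is a correspondence between X and Y with dis(R^ε) ≤ dis(R) + 4ε, and R^ε is compatible with the split geodesic marks: each of R^ε ∩ ({γ(0)} × {δ(0)}), R^ε ∩ (γ([0,r]) × δ([0,r'])), R^ε ∩ ({γ(r)} × {δ(r')}), and R^ε ∩ (γ([r,ℓ]) × δ([r',m])) is a correspondence between the two indicated sets. -/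
open scoped ENNReal

/-- The `ε`-enlargement `R^ε` of a correspondence `R`. -/
def corrEnlarge {α β : Type*} [PseudoMetricSpace α] [PseudoMetricSpace β]
    (R : Set (α × β)) (ε : ℝ) : Set (α × β) :=
  {p | ∃ q ∈ R, dist p.1 q.1 < ε ∧ dist p.2 q.2 < ε}

section CorrEnlarge

variable {α β : Type*} [PseudoMetricSpace α] [PseudoMetricSpace β] {R : Set (α × β)} {ε : ℝ}

theorem ofReal_abs_dist_sub_le_corrDis {p q : α × β} (hp : p ∈ R) (hq : q ∈ R) :
    ENNReal.ofReal |dist p.1 q.1 - dist p.2 q.2| ≤ corrDis R :=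
  le_iSup₂_of_le p hp (le_iSup₂_of_le q hq le_rfl)

theorem subset_corrEnlarge (hε : 0 < ε) : R ⊆ corrEnlarge R ε :=
  fun p hp => ⟨p, hp, by simpa using hε, by simpa using hε⟩

theorem corrDis_corrEnlarge_le (hε : 0 ≤ ε) :
    corrDis (corrEnlarge R ε) ≤ corrDis R + ENNReal.ofReal (4 * ε) := by
  refine iSup₂_le fun p hp => iSup₂_le fun q hq => ?_
  obtain ⟨p', hp', hp₁, hp₂⟩ := hp
  obtain ⟨q', hq', hq₁, hq₂⟩ := hq
  have h₁ := dist_dist_dist_le p.1 q.1 p'.1 q'.1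
  have h₂ := dist_dist_dist_le p.2 q.2 p'.2 q'.2
  rw [Real.dist_eq, abs_le] at h₁ h₂
  have hR := abs_le.1 (le_refl |dist p'.1 q'.1 - dist p'.2 q'.2|)
  calc ENNReal.ofReal |dist p.1 q.1 - dist p.2 q.2|
      ≤ ENNReal.ofReal (|dist p'.1 q'.1 - dist p'.2 q'.2| + 4 * ε) :=
        ENNReal.ofReal_le_ofReal (abs_le.2 ⟨by linarith, by linarith⟩)
    _ = ENNReal.ofReal |dist p'.1 q'.1 - dist p'.2 q'.2| + ENNReal.ofReal (4 * ε) :=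
        ENNReal.ofReal_add (abs_nonneg _) (by positivity)
    _ ≤ corrDis R + ENNReal.ofReal (4 * ε) := by
        gcongr
        exact ofReal_abs_dist_sub_le_corrDis hp' hq'

theorem mem_corrEnlarge_of_dist_fst_lt {a a' : α} {b : β} (h : (a', b) ∈ R) (ha : dist a a' < ε) :
    (a, b) ∈ corrEnlarge R ε :=
  ⟨(a', b), h, ha, by simpa using dist_nonneg.trans_lt ha⟩

theorem mem_corrEnlarge_of_dist_snd_lt {a : α} {b b' : β} (h : (a, b') ∈ R) (hb : dist b b' < ε) :
    (a, b) ∈ corrEnlarge R ε :=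
  ⟨(a, b'), h, by simpa using dist_nonneg.trans_lt hb, hb⟩

/-- If the initial points of two geodesics correspond, then the parameters of any two
corresponding points on them differ by at most the distortion. -/
theorem ofReal_abs_sub_le_corrDis {ℓ m : ℝ} {γ : ℝ → α} {δ : ℝ → β}
    (hγ : ∀ s ∈ Set.Icc (0:ℝ) ℓ, ∀ t ∈ Set.Icc (0:ℝ) ℓ, dist (γ s) (γ t) = |s - t|)
    (hδ : ∀ s ∈ Set.Icc (0:ℝ) m, ∀ t ∈ Set.Icc (0:ℝ) m, dist (δ s) (δ t) = |s - t|)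
    (hR0 : (γ 0, δ 0) ∈ R) {s t : ℝ} (hs : s ∈ Set.Icc 0 ℓ) (ht : t ∈ Set.Icc 0 m)
    (hst : (γ s, δ t) ∈ R) : ENNReal.ofReal |s - t| ≤ corrDis R := by
  have h := ofReal_abs_dist_sub_le_corrDis hst hR0
  rwa [hγ s hs 0 ⟨le_rfl, hs.1.trans hs.2⟩, hδ t ht 0 ⟨le_rfl, ht.1.trans ht.2⟩, sub_zero,
    sub_zero, abs_of_nonneg hs.1, abs_of_nonneg ht.1] at h

end CorrEnlarge

/-- the enlargement `R^ε` of a correspondence compatible with geodesic marks is a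
correspondence with distortion at most `dis(R) + 4ε`, compatible with the split geodesic marks. -/
theorem corrEnlarge_split_geodesic
    {X Y : Type*} [MetricSpace X] [MetricSpace Y]
    (ℓ m : ℝ) (γ : ℝ → X) (δ : ℝ → Y)
    (hγ : ∀ s ∈ Set.Icc (0:ℝ) ℓ, ∀ t ∈ Set.Icc (0:ℝ) ℓ, dist (γ s) (γ t) = |s - t|)
    (hδ : ∀ s ∈ Set.Icc (0:ℝ) m, ∀ t ∈ Set.Icc (0:ℝ) m, dist (δ s) (δ t) = |s - t|)
    (R : Set (X × Y))
    (hRcorr : (∀ x : X, ∃ y : Y, (x, y) ∈ R) ∧ (∀ y : Y, ∃ x : X, (x, y) ∈ R))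
    (hR0 : (γ 0, δ 0) ∈ R)
    (hRmark : (∀ a ∈ γ '' Set.Icc (0:ℝ) ℓ, ∃ b ∈ δ '' Set.Icc (0:ℝ) m, (a, b) ∈ R) ∧
              (∀ b ∈ δ '' Set.Icc (0:ℝ) m, ∃ a ∈ γ '' Set.Icc (0:ℝ) ℓ, (a, b) ∈ R))
    (r r' ε : ℝ) (hr : r ∈ Set.Ioo 0 ℓ) (hr' : r' ∈ Set.Ioo 0 m) (hε0 : 0 < ε)
    (hε : corrDis R + ENNReal.ofReal (max |r - r'| |ℓ - m|) < ENNReal.ofReal ε) :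
    ((∀ x : X, ∃ y : Y, (x, y) ∈ corrEnlarge R ε) ∧
     (∀ y : Y, ∃ x : X, (x, y) ∈ corrEnlarge R ε)) ∧
    corrDis (corrEnlarge R ε) ≤ corrDis R + ENNReal.ofReal (4 * ε) ∧
    (γ 0, δ 0) ∈ corrEnlarge R ε ∧
    ((∀ a ∈ γ '' Set.Icc (0:ℝ) r, ∃ b ∈ δ '' Set.Icc (0:ℝ) r', (a, b) ∈ corrEnlarge R ε) ∧
     (∀ b ∈ δ '' Set.Icc (0:ℝ) r', ∃ a ∈ γ '' Set.Icc (0:ℝ) r, (a, b) ∈ corrEnlarge R ε)) ∧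
    (γ r, δ r') ∈ corrEnlarge R ε ∧
    ((∀ a ∈ γ '' Set.Icc r ℓ, ∃ b ∈ δ '' Set.Icc r' m, (a, b) ∈ corrEnlarge R ε) ∧
     (∀ b ∈ δ '' Set.Icc r' m, ∃ a ∈ γ '' Set.Icc r ℓ, (a, b) ∈ corrEnlarge R ε)) := by
  have key : ∀ s ∈ Set.Icc (0:ℝ) ℓ, ∀ t ∈ Set.Icc (0:ℝ) m, (γ s, δ t) ∈ R →
      |(s - t) - (r - r')| < ε := by
    intro s hs t ht hst
    refine (abs_sub _ _).trans_lt ((ENNReal.ofReal_lt_ofReal_iff hε0).1 (lt_of_le_of_lt ?_ hε))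
    rw [ENNReal.ofReal_add (abs_nonneg _) (abs_nonneg _)]
    gcongr
    · exact ofReal_abs_sub_le_corrDis hγ hδ hR0 hs ht hst
    · exact le_max_left _ _
  have left : ∀ s ∈ Set.Icc (0:ℝ) ℓ, ∃ t ∈ Set.Icc (0:ℝ) m, (γ s, δ t) ∈ R := by
    intro s hs
    obtain ⟨_, ⟨t, ht, rfl⟩, h⟩ := hRmark.1 _ ⟨s, hs, rfl⟩
    exact ⟨t, ht, h⟩
  have right : ∀ t ∈ Set.Icc (0:ℝ) m, ∃ s ∈ Set.Icc (0:ℝ) ℓ, (γ s, δ t) ∈ R := by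
    intro t ht
    obtain ⟨_, ⟨s, hs, rfl⟩, h⟩ := hRmark.2 _ ⟨t, ht, rfl⟩
    exact ⟨s, hs, h⟩
  have hrI : r ∈ Set.Icc 0 ℓ := Set.Ioo_subset_Icc_self hr
  have hrI' : r' ∈ Set.Icc 0 m := Set.Ioo_subset_Icc_self hr'
  have near_fst : ∀ s ∈ Set.Icc (0:ℝ) ℓ, ∀ t, (γ s, δ t) ∈ R → |r - s| < ε →
      (γ r, δ t) ∈ corrEnlarge R ε := fun s hs t hst h =>
    mem_corrEnlarge_of_dist_fst_lt hst (by rwa [hγ r hrI s hs])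
  have near_snd : ∀ s, ∀ t ∈ Set.Icc (0:ℝ) m, (γ s, δ t) ∈ R → |r' - t| < ε →
      (γ s, δ r') ∈ corrEnlarge R ε := fun s t ht hst h =>
    mem_corrEnlarge_of_dist_snd_lt hst (by rwa [hδ r' hrI' t ht])
  have hsub : R ⊆ corrEnlarge R ε := subset_corrEnlarge hε0
  refine ⟨⟨fun x => (hRcorr.1 x).imp fun _ h => hsub h,
    fun y => (hRcorr.2 y).imp fun _ h => hsub h⟩, corrDis_corrEnlarge_le hε0.le, hsub hR0,
    ⟨?_, ?_⟩, ?_, ?_, ?_⟩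
  · rintro _ ⟨s, hs, rfl⟩
    have hsI : s ∈ Set.Icc 0 ℓ := ⟨hs.1, hs.2.trans hrI.2⟩
    obtain ⟨t, ht, hst⟩ := left s hsI
    rcases le_total t r' with h | h
    · exact ⟨_, ⟨t, ⟨ht.1, h⟩, rfl⟩, hsub hst⟩
    · refine ⟨_, ⟨r', ⟨hrI'.1, le_rfl⟩, rfl⟩, near_snd s t ht hst ?_⟩
      obtain ⟨h₁, h₂⟩ := abs_lt.1 (key s hsI t ht hst)
      exact abs_lt.2 ⟨by linarith [hs.2], by linarith [hs.2]⟩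
  · rintro _ ⟨t, ht, rfl⟩
    have htI : t ∈ Set.Icc 0 m := ⟨ht.1, ht.2.trans hrI'.2⟩
    obtain ⟨s, hs, hst⟩ := right t htI
    rcases le_total s r with h | h
    · exact ⟨_, ⟨s, ⟨hs.1, h⟩, rfl⟩, hsub hst⟩
    · refine ⟨_, ⟨r, ⟨hrI.1, le_rfl⟩, rfl⟩, near_fst s hs t hst ?_⟩
      obtain ⟨h₁, h₂⟩ := abs_lt.1 (key s hs t htI hst)
      exact abs_lt.2 ⟨by linarith [ht.2], by linarith [ht.2]⟩
  · obtain ⟨t, ht, hrt⟩ := left r hrI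
    refine near_snd r t ht hrt ?_
    obtain ⟨h₁, h₂⟩ := abs_lt.1 (key r hrI t ht hrt)
    exact abs_lt.2 ⟨by linarith, by linarith⟩
  · rintro _ ⟨s, hs, rfl⟩
    have hsI : s ∈ Set.Icc 0 ℓ := ⟨hrI.1.trans hs.1, hs.2⟩
    obtain ⟨t, ht, hst⟩ := left s hsI
    rcases le_total r' t with h | h
    · exact ⟨_, ⟨t, ⟨h, ht.2⟩, rfl⟩, hsub hst⟩
    · refine ⟨_, ⟨r', ⟨le_rfl, hrI'.2⟩, rfl⟩, near_snd s t ht hst ?_⟩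
      obtain ⟨h₁, h₂⟩ := abs_lt.1 (key s hsI t ht hst)
      exact abs_lt.2 ⟨by linarith [hs.1], by linarith [hs.1]⟩
  · rintro _ ⟨t, ht, rfl⟩
    have htI : t ∈ Set.Icc 0 m := ⟨hrI'.1.trans ht.1, ht.2⟩
    obtain ⟨s, hs, hst⟩ := right t htI
    rcases le_total r s with h | h
    · exact ⟨_, ⟨s, ⟨h, hs.2⟩, rfl⟩, hsub hst⟩
    · refine ⟨_, ⟨r, ⟨le_rfl, hrI.2⟩, rfl⟩, near_fst s hs t hst ?_⟩
      obtain ⟨h₁, h₂⟩ := abs_lt.1 (key s hs t htI hst)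
      exact abs_lt.2 ⟨by linarith [ht.1], by linarith [ht.1]⟩
end

section
/- Let X, Y, X', Y' be metric spaces, let γ : [0,ℓ] → X and ξ : [0,ℓ] → Y be geodesics of the same length ℓ, and let γ' : [0,ℓ'] → X' and ξ' : [0,ℓ'] → Y' be geodesics of the same length ℓ'. Let d_G be the pseudometric on the disjoint union X ⊔ Y which equals d_X on X × X, d_Y on Y × Y, and d_G(x,y) = inf{ d_X(x,γ(t)) + d_Y(ξ(t),y) : t ∈ [0,ℓ] } for x ∈ X, y ∈ Y; define d_{G'} on X' ⊔ Y' analogously from γ' and ξ'. Let R be a correspondence between X and X' such that (γ(0),γ'(0)) ∈ R and R ∩ (γ([0,ℓ]) × γ'([0,ℓ'])) is a correspondence between γ([0,ℓ]) and γ'([0,ℓ']), and let R' be a correspondence between Y and Y' such that (ξ(0),ξ'(0)) ∈ R' and R' ∩ (ξ([0,ℓ]) × ξ'([0,ℓ'])) is a correspondence between ξ([0,ℓ]) and ξ'([0,ℓ']). Then R'' = R ∪ R' is a correspondence between (X ⊔ Y, d_G) and (X' ⊔ Y', d_{G'}), and dis(R'') ≤ 2·(dis(R) + dis(R')). -/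
open scoped ENNReal

/-- Distortion of a correspondence `R ⊆ α × β` with respect to two `[0,∞]`-valued
distance functions (`(a ⊔ b) − (a ⊓ b)` computed via truncated subtraction equals `|a − b|`). -/
noncomputable def disWith {α β : Type*} (dα : α → α → ℝ≥0∞) (dβ : β → β → ℝ≥0∞)
    (R : Set (α × β)) : ℝ≥0∞ :=
  ⨆ p ∈ R, ⨆ q ∈ R, ((dα p.1 q.1 - dβ p.2 q.2) ⊔ (dβ p.2 q.2 - dα p.1 q.1))

/-- The pseudometric on `X ⊔ Y` of the metric gluing of `X` and `Y` along geodesics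
`γ : [0,ℓ] → X` and `ξ : [0,ℓ] → Y`. -/
noncomputable def glueDist {X Y : Type*} [MetricSpace X] [MetricSpace Y]
    (γ : ℝ → X) (ξ : ℝ → Y) (ℓ : ℝ) : X ⊕ Y → X ⊕ Y → ℝ≥0∞
  | Sum.inl x, Sum.inl x' => edist x x'
  | Sum.inr y, Sum.inr y' => edist y y'
  | Sum.inl x, Sum.inr y => ⨅ t ∈ Set.Icc (0:ℝ) ℓ, (edist x (γ t) + edist (ξ t) y)
  | Sum.inr y, Sum.inl x => ⨅ t ∈ Set.Icc (0:ℝ) ℓ, (edist x (γ t) + edist (ξ t) y)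

/-- The correspondence between `X ⊔ Y` and `X' ⊔ Y'` induced by correspondences
`R ⊆ X × X'` and `R' ⊆ Y × Y'`. -/
def sumCorr {X Y X' Y' : Type*} (R : Set (X × X')) (R' : Set (Y × Y')) :
    Set ((X ⊕ Y) × (X' ⊕ Y')) :=
  (fun p : X × X' => ((Sum.inl p.1 : X ⊕ Y), (Sum.inl p.2 : X' ⊕ Y'))) '' R ∪
  (fun p : Y × Y' => ((Sum.inr p.1 : X ⊕ Y), (Sum.inr p.2 : X' ⊕ Y'))) '' R'

/-- Bounding `disWith` from above amounts to bounding the two one-sided differences. -/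
theorem disWith_le_iff {α β : Type*} {dα : α → α → ℝ≥0∞} {dβ : β → β → ℝ≥0∞}
    {R : Set (α × β)} {C : ℝ≥0∞} :
    disWith dα dβ R ≤ C ↔ ∀ a b a' b', (a, b) ∈ R → (a', b') ∈ R →
      dα a a' ≤ dβ b b' + C ∧ dβ b b' ≤ dα a a' + C := by
  simp only [disWith, iSup_le_iff, sup_le_iff, tsub_le_iff_left, Prod.forall]
  exact ⟨fun h a b a' b' hp hq => h a b hp a' b' hq, fun h a b hp a' b' hq => h a b a' b' hp hq⟩

/-- Two nonnegative reals whose distances to `0` differ by at most `C` are at distance at most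
`C`. -/
theorem edist_le_of_edist_zero_le {s t : ℝ} (hs : 0 ≤ s) (ht : 0 ≤ t) {C : ℝ≥0∞}
    (h₁ : edist 0 t ≤ edist 0 s + C) (h₂ : edist 0 s ≤ edist 0 t + C) : edist s t ≤ C := by
  induction C with
  | top => exact le_top
  | coe c =>
    simp only [edist_nndist, ← ENNReal.coe_add, ENNReal.coe_le_coe] at h₁ h₂ ⊢
    simp only [← NNReal.coe_le_coe, NNReal.coe_add, coe_nndist, Real.dist_eq, zero_sub, abs_neg,
      abs_of_nonneg hs, abs_of_nonneg ht] at h₁ h₂ ⊢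
    rw [abs_le]
    constructor <;> linarith

/-- A map that preserves real distances preserves extended distances. -/
theorem edist_eq_of_dist_eq_abs_sub {X : Type*} [PseudoMetricSpace X] {γ : ℝ → X} {s t : ℝ}
    (h : dist (γ s) (γ t) = |s - t|) : edist (γ s) (γ t) = edist s t := by
  rw [edist_dist, edist_dist, h, Real.dist_eq]

/-- Related points on two geodesics with related origins have parameters at distance at most the
distortion. -/
theorem edist_param_le_of_disWith_le {X X' : Type*} [MetricSpace X] [MetricSpace X'] {ℓ ℓ' : ℝ}
    (hℓ : 0 ≤ ℓ) (hℓ' : 0 ≤ ℓ') {γ : ℝ → X} {γ' : ℝ → X'}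
    (hγ : ∀ s ∈ Set.Icc (0:ℝ) ℓ, ∀ t ∈ Set.Icc (0:ℝ) ℓ, dist (γ s) (γ t) = |s - t|)
    (hγ' : ∀ s ∈ Set.Icc (0:ℝ) ℓ', ∀ t ∈ Set.Icc (0:ℝ) ℓ', dist (γ' s) (γ' t) = |s - t|)
    {R : Set (X × X')} (hR0 : (γ 0, γ' 0) ∈ R) {A : ℝ≥0∞}
    (hA : disWith (fun x z : X => edist x z) (fun x z : X' => edist x z) R ≤ A)
    {s t : ℝ} (ht : t ∈ Set.Icc (0:ℝ) ℓ) (hs : s ∈ Set.Icc (0:ℝ) ℓ')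
    (hts : (γ t, γ' s) ∈ R) : edist s t ≤ A := by
  have h := disWith_le_iff.1 hA _ _ _ _ hR0 hts
  simp only [edist_eq_of_dist_eq_abs_sub (hγ 0 ⟨le_rfl, hℓ⟩ t ht),
    edist_eq_of_dist_eq_abs_sub (hγ' 0 ⟨le_rfl, hℓ'⟩ s hs)] at h
  exact edist_le_of_edist_zero_le hs.1 ht.1 h.1 h.2

/-- The distance function of a metric gluing is symmetric. -/
theorem glueDist_comm {X Y : Type*} [MetricSpace X] [MetricSpace Y]
    (γ : ℝ → X) (ξ : ℝ → Y) (ℓ : ℝ) (a b : X ⊕ Y) :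
    glueDist γ ξ ℓ a b = glueDist γ ξ ℓ b a := by
  rcases a with a | a <;> rcases b with b | b <;> simp [glueDist, edist_comm]

/-- Distortion is unchanged when a correspondence is reversed. -/
theorem disWith_swap {α β : Type*} (dα : α → α → ℝ≥0∞) (dβ : β → β → ℝ≥0∞)
    (R : Set (α × β)) : disWith dβ dα (Prod.swap ⁻¹' R) = disWith dα dβ R := by
  refine eq_of_forall_ge_iff fun C => ?_
  rw [disWith_le_iff, disWith_le_iff]
  exact ⟨fun h a b a' b' hp hq => (h b a b' a' hp hq).symm,
    fun h b a b' a' hp hq => (h a b a' b' hp hq).symm⟩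

/-- One-sided comparison of the distances between the two sides of two metric gluings. -/
theorem glueDist_inl_inr_le {X Y X' Y' : Type*} [MetricSpace X] [MetricSpace Y] [MetricSpace X']
    [MetricSpace Y'] {ℓ ℓ' : ℝ} (hℓ : 0 ≤ ℓ) (hℓ' : 0 ≤ ℓ')
    {γ : ℝ → X} {ξ : ℝ → Y} {γ' : ℝ → X'} {ξ' : ℝ → Y'}
    (hγ : ∀ s ∈ Set.Icc (0:ℝ) ℓ, ∀ t ∈ Set.Icc (0:ℝ) ℓ, dist (γ s) (γ t) = |s - t|)
    (hξ : ∀ s ∈ Set.Icc (0:ℝ) ℓ, ∀ t ∈ Set.Icc (0:ℝ) ℓ, dist (ξ s) (ξ t) = |s - t|)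
    (hγ' : ∀ s ∈ Set.Icc (0:ℝ) ℓ', ∀ t ∈ Set.Icc (0:ℝ) ℓ', dist (γ' s) (γ' t) = |s - t|)
    (hξ' : ∀ s ∈ Set.Icc (0:ℝ) ℓ', ∀ t ∈ Set.Icc (0:ℝ) ℓ', dist (ξ' s) (ξ' t) = |s - t|)
    {R : Set (X × X')} {R' : Set (Y × Y')}
    (hR0 : (γ 0, γ' 0) ∈ R)
    (hRmark : ∀ a ∈ γ '' Set.Icc (0:ℝ) ℓ, ∃ b ∈ γ' '' Set.Icc (0:ℝ) ℓ', (a, b) ∈ R)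
    (hR'0 : (ξ 0, ξ' 0) ∈ R')
    (hR'mark : ∀ a ∈ ξ '' Set.Icc (0:ℝ) ℓ, ∃ b ∈ ξ' '' Set.Icc (0:ℝ) ℓ', (a, b) ∈ R')
    {A B : ℝ≥0∞}
    (hA : disWith (fun x z : X => edist x z) (fun x z : X' => edist x z) R ≤ A)
    (hB : disWith (fun y z : Y => edist y z) (fun y z : Y' => edist y z) R' ≤ B)
    {x : X} {x' : X'} {y : Y} {y' : Y'} (hx : (x, x') ∈ R) (hy : (y, y') ∈ R') :
    glueDist γ' ξ' ℓ' (Sum.inl x') (Sum.inr y') ≤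
      glueDist γ ξ ℓ (Sum.inl x) (Sum.inr y) + 2 * (A + B) := by
  simp only [glueDist]
  rw [← tsub_le_iff_right]
  refine le_iInf₂ fun t ht => ?_
  rw [tsub_le_iff_right]
  obtain ⟨_, ⟨s, hs, rfl⟩, hts⟩ := hRmark _ ⟨t, ht, rfl⟩
  obtain ⟨_, ⟨r, hr, rfl⟩, htr⟩ := hR'mark _ ⟨t, ht, rfl⟩
  have hst : edist s t ≤ A := edist_param_le_of_disWith_le hℓ hℓ' hγ hγ' hR0 hA ht hs hts
  have hrt : edist r t ≤ B := edist_param_le_of_disWith_le hℓ hℓ' hξ hξ' hR'0 hB ht hr htr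
  have hx' : edist x' (γ' s) ≤ edist x (γ t) + A := (disWith_le_iff.1 hA _ _ _ _ hx hts).2
  have hy' : edist (ξ' r) y' ≤ edist (ξ t) y + B := (disWith_le_iff.1 hB _ _ _ _ htr hy).2
  have hsr : edist (ξ' s) (ξ' r) ≤ A + B := by
    rw [edist_eq_of_dist_eq_abs_sub (hξ' s hs r hr)]
    exact (edist_triangle_right s r t).trans (add_le_add hst hrt)
  calc ⨅ t ∈ Set.Icc (0:ℝ) ℓ', (edist x' (γ' t) + edist (ξ' t) y')
      ≤ edist x' (γ' s) + edist (ξ' s) y' := iInf₂_le s hs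
    _ ≤ edist x' (γ' s) + (edist (ξ' s) (ξ' r) + edist (ξ' r) y') := by
      gcongr
      exact edist_triangle _ _ _
    _ ≤ (edist x (γ t) + A) + ((A + B) + (edist (ξ t) y + B)) := by gcongr
    _ = edist x (γ t) + edist (ξ t) y + 2 * (A + B) := by ring

/-- `R ∪ R'` is a correspondence between the glued spaces, of distortion at most
`2·(dis(R) + dis(R'))`. -/
theorem sumCorr_glue_distortion
    {X Y X' Y' : Type*} [MetricSpace X] [MetricSpace Y] [MetricSpace X'] [MetricSpace Y']
    (ℓ ℓ' : ℝ) (hℓ : 0 ≤ ℓ) (hℓ' : 0 ≤ ℓ')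
    (γ : ℝ → X) (ξ : ℝ → Y) (γ' : ℝ → X') (ξ' : ℝ → Y')
    (hγ : ∀ s ∈ Set.Icc (0:ℝ) ℓ, ∀ t ∈ Set.Icc (0:ℝ) ℓ, dist (γ s) (γ t) = |s - t|)
    (hξ : ∀ s ∈ Set.Icc (0:ℝ) ℓ, ∀ t ∈ Set.Icc (0:ℝ) ℓ, dist (ξ s) (ξ t) = |s - t|)
    (hγ' : ∀ s ∈ Set.Icc (0:ℝ) ℓ', ∀ t ∈ Set.Icc (0:ℝ) ℓ', dist (γ' s) (γ' t) = |s - t|)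
    (hξ' : ∀ s ∈ Set.Icc (0:ℝ) ℓ', ∀ t ∈ Set.Icc (0:ℝ) ℓ', dist (ξ' s) (ξ' t) = |s - t|)
    (R : Set (X × X')) (R' : Set (Y × Y'))
    (hRcorr : (∀ x : X, ∃ x' : X', (x, x') ∈ R) ∧ (∀ x' : X', ∃ x : X, (x, x') ∈ R))
    (hR'corr : (∀ y : Y, ∃ y' : Y', (y, y') ∈ R') ∧ (∀ y' : Y', ∃ y : Y, (y, y') ∈ R'))
    (hR0 : (γ 0, γ' 0) ∈ R)
    (hRmark : (∀ a ∈ γ '' Set.Icc (0:ℝ) ℓ, ∃ b ∈ γ' '' Set.Icc (0:ℝ) ℓ', (a, b) ∈ R) ∧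
              (∀ b ∈ γ' '' Set.Icc (0:ℝ) ℓ', ∃ a ∈ γ '' Set.Icc (0:ℝ) ℓ, (a, b) ∈ R))
    (hR'0 : (ξ 0, ξ' 0) ∈ R')
    (hR'mark : (∀ a ∈ ξ '' Set.Icc (0:ℝ) ℓ, ∃ b ∈ ξ' '' Set.Icc (0:ℝ) ℓ', (a, b) ∈ R') ∧
               (∀ b ∈ ξ' '' Set.Icc (0:ℝ) ℓ', ∃ a ∈ ξ '' Set.Icc (0:ℝ) ℓ, (a, b) ∈ R')) :
    ((∀ a : X ⊕ Y, ∃ b : X' ⊕ Y', (a, b) ∈ sumCorr R R') ∧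
     (∀ b : X' ⊕ Y', ∃ a : X ⊕ Y, (a, b) ∈ sumCorr R R')) ∧
    disWith (glueDist γ ξ ℓ) (glueDist γ' ξ' ℓ') (sumCorr R R') ≤
      2 * (disWith (fun x x' : X => edist x x') (fun x x' : X' => edist x x') R +
           disWith (fun y y' : Y => edist y y') (fun y y' : Y' => edist y y') R') := by
  refine ⟨⟨?_, ?_⟩, ?_⟩
  · rintro (x | y)
    · obtain ⟨x', h⟩ := hRcorr.1 x
      exact ⟨Sum.inl x', Or.inl ⟨_, h, rfl⟩⟩
    · obtain ⟨y', h⟩ := hR'corr.1 y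
      exact ⟨Sum.inr y', Or.inr ⟨_, h, rfl⟩⟩
  · rintro (x' | y')
    · obtain ⟨x, h⟩ := hRcorr.2 x'
      exact ⟨Sum.inl x, Or.inl ⟨_, h, rfl⟩⟩
    · obtain ⟨y, h⟩ := hR'corr.2 y'
      exact ⟨Sum.inr y, Or.inr ⟨_, h, rfl⟩⟩
  · set A := disWith (fun x x' : X => edist x x') (fun x x' : X' => edist x x') R with hA
    set B := disWith (fun y y' : Y => edist y y') (fun y y' : Y' => edist y y') R' with hB
    have hAC : A ≤ 2 * (A + B) := by
      rw [two_mul]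
      exact le_self_add.trans le_self_add
    have hBC : B ≤ 2 * (A + B) := by
      rw [two_mul]
      exact le_add_self.trans le_self_add
    have cross : ∀ x x' y y', (x, x') ∈ R → (y, y') ∈ R' →
        glueDist γ ξ ℓ (Sum.inl x) (Sum.inr y) ≤
          glueDist γ' ξ' ℓ' (Sum.inl x') (Sum.inr y') + 2 * (A + B) ∧
        glueDist γ' ξ' ℓ' (Sum.inl x') (Sum.inr y') ≤
          glueDist γ ξ ℓ (Sum.inl x) (Sum.inr y) + 2 * (A + B) := fun x x' y y' hx hy =>
      ⟨glueDist_inl_inr_le (R := Prod.swap ⁻¹' R) (R' := Prod.swap ⁻¹' R') hℓ' hℓ hγ' hξ' hγ hξ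
          hR0 hRmark.2 hR'0 hR'mark.2 (disWith_swap _ _ R).le (disWith_swap _ _ R').le hx hy,
        glueDist_inl_inr_le hℓ hℓ' hγ hξ hγ' hξ' hR0 hRmark.1 hR'0 hR'mark.1 hA.ge hB.ge hx hy⟩
    rw [disWith_le_iff]
    rintro _ _ _ _ (⟨⟨x, x'⟩, hx, hp⟩ | ⟨⟨y, y'⟩, hy, hp⟩)
      (⟨⟨z, z'⟩, hz, hq⟩ | ⟨⟨z, z'⟩, hz, hq⟩) <;> cases hp <;> cases hq
    · exact disWith_le_iff.1 (hA.ge.trans hAC) _ _ _ _ hx hz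
    · exact cross _ _ _ _ hx hz
    · rw [glueDist_comm γ ξ, glueDist_comm γ' ξ']
      exact cross _ _ _ _ hz hy
    · exact disWith_le_iff.1 (hB.ge.trans hBC) _ _ _ _ hy hz
end

section
/- Let f and g be continuous real-valued functions on a common closed interval I ⊆ ℝ. Then D_{f,g} is a pseudometric on I satisfying: D_{f,g}(s,t) ≤ d_g(s,t) for all s, t ∈ I; D_{f,g}(s,t) = 0 whenever d_f(s,t) = 0; and |D_{f,g}(s,t) − D_{f,g}(s',t')| ≤ 2·ω(g;[s∧s', s∨s']) + 2·ω(g;[t∧t', t∨t']) for all s, s', t, t' ∈ I. -/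
open scoped ENNReal

/-- The quotient pseudometric `d/R` of an extended pseudometric `d` by a relation `R`, with
all chain points constrained to lie in the set `S`. -/
noncomputable def quotDistOn {α : Type*} (d : α → α → ℝ≥0∞) (R : α → α → Prop)
    (S : Set α) (x y : α) : ℝ≥0∞ :=
  ⨅ (n : ℕ) (a : Fin (n + 1) → α) (b : Fin (n + 1) → α)
    (_ : ∀ i, a i ∈ S) (_ : ∀ i, b i ∈ S)
    (_ : a 0 = x) (_ : b (Fin.last n) = y)
    (_ : ∀ i : Fin n, R (b i.castSucc) (a i.succ)),
    ∑ i, d (a i) (b i)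

/-- The quotient pseudometric `D_{f,g} = d_g / {d_f = 0}` on the interval `I`. -/
noncomputable def Dquot (f g : ℝ → ℝ) (I : Set ℝ) : ℝ → ℝ → ℝ≥0∞ :=
  quotDistOn (fun s t => ENNReal.ofReal (dOf g s t)) (fun s t => dOf f s t = 0) I

/-- The value of any admissible chain bounds the quotient distance from above. -/
theorem quotDistOn_le_sum {α : Type*} {d : α → α → ℝ≥0∞} {R : α → α → Prop} {S : Set α}
    {n : ℕ} (a b : Fin (n + 1) → α) (ha : ∀ i, a i ∈ S) (hb : ∀ i, b i ∈ S)
    (hR : ∀ i : Fin n, R (b i.castSucc) (a i.succ)) :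
    quotDistOn d R S (a 0) (b (Fin.last n)) ≤ ∑ i, d (a i) (b i) :=
  iInf_le_of_le n <| iInf_le_of_le a <| iInf_le_of_le b <| iInf_le_of_le ha <|
    iInf_le_of_le hb <| iInf_le_of_le rfl <| iInf_le_of_le rfl <| iInf_le_of_le hR le_rfl

theorem quotDistOn_le {α : Type*} (d : α → α → ℝ≥0∞) (R : α → α → Prop) {S : Set α}
    {x y : α} (hx : x ∈ S) (hy : y ∈ S) : quotDistOn d R S x y ≤ d x y := by
  simpa using quotDistOn_le_sum (d := d) (R := R) (n := 0) (fun _ => x) (fun _ => y)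
    (fun _ => hx) (fun _ => hy) (fun i => i.elim0)

theorem quotDistOn_eq_zero {α : Type*} {d : α → α → ℝ≥0∞} {R : α → α → Prop} {S : Set α}
    (hd : ∀ z, d z z = 0) {x y : α} (hx : x ∈ S) (hy : y ∈ S) (hxy : R x y) :
    quotDistOn d R S x y = 0 := by
  have hS : ∀ i, (![x, y] : Fin 2 → α) i ∈ S := by
    intro i
    fin_cases i <;> simpa
  have h := quotDistOn_le_sum (d := d) (R := R) (n := 1) ![x, y] ![x, y] hS hS
    (fun i => by fin_cases i; simpa)
  simpa [hd] using h

theorem quotDistOn_symm_le {α : Type*} {d : α → α → ℝ≥0∞} {R : α → α → Prop} {S : Set α}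
    (hd : ∀ x y, d x y = d y x) (hR : ∀ x y, R x y → R y x) (x y : α) :
    quotDistOn d R S x y ≤ quotDistOn d R S y x := by
  refine le_iInf fun n => le_iInf fun a => le_iInf fun b => le_iInf fun ha => le_iInf fun hb =>
    le_iInf fun hx => le_iInf fun hy => le_iInf fun h => ?_
  have key := quotDistOn_le_sum (d := d) (R := R) (S := S) (fun i => b i.rev) (fun i => a i.rev)
    (fun i => hb _) (fun i => ha _) (fun i => by
      rw [Fin.rev_castSucc, Fin.rev_succ]
      exact hR _ _ (h i.rev))
  simp only [Fin.rev_zero, Fin.rev_last, hx, hy] at key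
  refine key.trans_eq ?_
  simp_rw [hd (b _)]
  exact Equiv.sum_comp Fin.revPerm fun i => d (a i) (b i)

theorem quotDistOn_triangle {α : Type*} {d : α → α → ℝ≥0∞} {R : α → α → Prop} {S : Set α}
    (hR : ∀ x, R x x) (x y z : α) :
    quotDistOn d R S x z ≤ quotDistOn d R S x y + quotDistOn d R S y z := by
  conv_rhs => unfold quotDistOn
  simp only [ENNReal.iInf_add, ENNReal.add_iInf]
  simp only [le_iInf_iff]
  intro m a' b' ha' hb' hay hbz h' n a b ha hb hax hby h
  have key := quotDistOn_le_sum (d := d) (R := R) (S := S) (n := n + 1 + m)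
    (Fin.append a a' : Fin (n + 1 + (m + 1)) → α) (Fin.append b b' : Fin (n + 1 + (m + 1)) → α)
    (fun i => by
      refine Fin.addCases (m := n + 1) (n := m + 1) (fun j => ?_) (fun j => ?_) i
      · simpa only [Fin.append_left] using ha j
      · simpa only [Fin.append_right] using ha' j)
    (fun i => by
      refine Fin.addCases (m := n + 1) (n := m + 1) (fun j => ?_) (fun j => ?_) i
      · simpa only [Fin.append_left] using hb j
      · simpa only [Fin.append_right] using hb' j)
    (fun i => by
      refine Fin.addCases (m := n + 1) (n := m) (fun j => ?_) (fun j => ?_) i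
      · have e : (Fin.castAdd m j).castSucc = Fin.castAdd (m + 1) j := rfl
        rw [e, Fin.append_left]
        refine Fin.lastCases ?_ (fun k => ?_) j
        · have e' : (Fin.castAdd m (Fin.last n)).succ = Fin.natAdd (n + 1) (0 : Fin (m + 1)) := rfl
          rw [e', Fin.append_right, hby, hay]
          exact hR y
        · have e' : (Fin.castAdd m k.castSucc).succ = Fin.castAdd (m + 1) k.succ := rfl
          rw [e', Fin.append_left]
          exact h k
      · have e : (Fin.natAdd (n + 1) j).castSucc = Fin.natAdd (n + 1) j.castSucc := rfl
        have e' : (Fin.natAdd (n + 1) j).succ = Fin.natAdd (n + 1) j.succ := rfl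
        rw [e, e', Fin.append_right, Fin.append_right]
        exact h' j)
  have e0 : (0 : Fin (n + 1 + m + 1)) = Fin.castAdd (m + 1) (0 : Fin (n + 1)) := rfl
  have el : Fin.last (n + 1 + m) = Fin.natAdd (n + 1) (Fin.last m) := rfl
  rw [e0, el, Fin.append_left, Fin.append_right, hax, hbz] at key
  refine key.trans_eq ?_
  refine (Fin.sum_univ_add (a := n + 1) (b := m + 1) _).trans ?_
  simp only [Fin.append_left, Fin.append_right]

theorem dOf_self (f : ℝ → ℝ) (s : ℝ) : dOf f s s = 0 := by
  simp [dOf]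
  ring

theorem dOf_comm (f : ℝ → ℝ) (s t : ℝ) : dOf f s t = dOf f t s := by
  simp only [dOf, min_comm s t, max_comm s t, add_comm (f s)]

theorem dOf_le_two_mul_osc {g : ℝ → ℝ} {s t : ℝ}
    (hg : ContinuousOn g (Set.Icc (min s t) (max s t))) :
    dOf g s t ≤ 2 * osc g (Set.Icc (min s t) (max s t)) := by
  have hbdd := (isCompact_Icc.image_of_continuousOn hg).bddAbove
  have hs := le_csSup hbdd (Set.mem_image_of_mem g ⟨min_le_left s t, le_max_left s t⟩)
  have ht := le_csSup hbdd (Set.mem_image_of_mem g ⟨min_le_right s t, le_max_right s t⟩)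
  unfold dOf osc
  linarith

theorem osc_nonneg {g : ℝ → ℝ} {J : Set ℝ} (hJ : IsCompact J) (hg : ContinuousOn g J) :
    0 ≤ osc g J := by
  have h := hJ.image_of_continuousOn hg
  exact sub_nonneg.2 (Real.sInf_le_sSup _ h.bddBelow h.bddAbove)

/-- `D_{f,g}` is a pseudometric on `I`, bounded by `d_g`, vanishing on
`{d_f = 0}`, and continuous in terms of the modulus of `g`. -/
theorem Dquot_pseudometric
    (I : Set ℝ) (hIclosed : IsClosed I) (hIconn : I.OrdConnected)
    (f g : ℝ → ℝ) (hf : ContinuousOn f I) (hg : ContinuousOn g I) :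
    (∀ s ∈ I, Dquot f g I s s = 0) ∧
    (∀ s ∈ I, ∀ t ∈ I, Dquot f g I s t = Dquot f g I t s) ∧
    (∀ s ∈ I, ∀ t ∈ I, ∀ u ∈ I, Dquot f g I s u ≤ Dquot f g I s t + Dquot f g I t u) ∧
    (∀ s ∈ I, ∀ t ∈ I, Dquot f g I s t ≤ ENNReal.ofReal (dOf g s t)) ∧
    (∀ s ∈ I, ∀ t ∈ I, dOf f s t = 0 → Dquot f g I s t = 0) ∧
    (∀ s ∈ I, ∀ s' ∈ I, ∀ t ∈ I, ∀ t' ∈ I,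
      (Dquot f g I s t - Dquot f g I s' t') ⊔ (Dquot f g I s' t' - Dquot f g I s t) ≤
        ENNReal.ofReal (2 * osc g (Set.Icc (min s s') (max s s')) +
          2 * osc g (Set.Icc (min t t') (max t t')))) := by
  have hself : ∀ s, ENNReal.ofReal (dOf g s s) = 0 := fun s => by simp [dOf_self]
  have hle : ∀ s ∈ I, ∀ t ∈ I, Dquot f g I s t ≤ ENNReal.ofReal (dOf g s t) :=
    fun s hs t ht => quotDistOn_le _ _ hs ht
  have hsymm_le : ∀ s t, Dquot f g I s t ≤ Dquot f g I t s :=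
    quotDistOn_symm_le (fun s t => by rw [dOf_comm]) (fun s t h => by rwa [dOf_comm])
  have htri : ∀ s t u, Dquot f g I s u ≤ Dquot f g I s t + Dquot f g I t u :=
    quotDistOn_triangle (dOf_self f)
  have hcont : ∀ s ∈ I, ∀ t ∈ I, ContinuousOn g (Set.Icc (min s t) (max s t)) :=
    fun s hs t ht => hg.mono (hIconn.uIcc_subset hs ht)
  have hosc : ∀ s ∈ I, ∀ t ∈ I,
      Dquot f g I s t ≤ ENNReal.ofReal (2 * osc g (Set.Icc (min s t) (max s t))) :=
    fun s hs t ht => (hle s hs t ht).trans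
      (ENNReal.ofReal_le_ofReal (dOf_le_two_mul_osc (hcont s hs t ht)))
  refine ⟨fun s hs => le_antisymm ((hle s hs s hs).trans_eq (hself s)) bot_le,
    fun s _ t _ => le_antisymm (hsymm_le s t) (hsymm_le t s),
    fun s _ t _ u _ => htri s t u, hle,
    fun s hs t ht h => quotDistOn_eq_zero hself hs ht h, ?_⟩
  intro s hs s' hs' t ht t' ht'
  have hs0 := osc_nonneg isCompact_Icc (hcont s hs s' hs')
  have ht0 := osc_nonneg isCompact_Icc (hcont t ht t' ht')
  rw [ENNReal.ofReal_add (by positivity) (by positivity)]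
  have hss := hosc s hs s' hs'
  have htt := hosc t ht t' ht'
  have bound : ∀ x y x' y', Dquot f g I x y - Dquot f g I x' y' ≤
      Dquot f g I x x' + Dquot f g I y' y := by
    intro x y x' y'
    rw [tsub_le_iff_right]
    calc Dquot f g I x y ≤ Dquot f g I x x' + (Dquot f g I x' y' + Dquot f g I y' y) :=
          (htri x x' y).trans (add_le_add_right (htri x' y' y) _)
      _ = _ := by ring
  exact sup_le
    ((bound s t s' t').trans (add_le_add hss ((hsymm_le t' t).trans htt)))
    ((bound s' t' s t).trans (add_le_add ((hsymm_le s' s).trans hss) htt))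
end

section
/- Let (f,g) be a slice trajectory on a closed interval I. Then |g(s) − g(t)| ≤ D_{f,g}(s,t) ≤ d_g(s,t) for all s, t ∈ I. Moreover, for t ∈ I set Γ_t(r) = inf{s ∈ I : s ≥ t and g(s) = g(t) − r}, defined for real 0 ≤ r ≤ g(t) − inf{g(u) : u ∈ I, u ≥ t}, and Ξ_t(r) = sup{s ∈ I : s ≤ t and g(s) = g(t) − r}, defined for real 0 ≤ r ≤ g(t) − inf{g(u) : u ∈ I, u ≤ t}. Then for all admissible r ≤ r': d_g(Γ_t(r),Γ_t(r')) = D_{f,g}(Γ_t(r),Γ_t(r')) = r' − r, and d_g(Ξ_t(r),Ξ_t(r')) = D_{f,g}(Ξ_t(r),Ξ_t(r')) = r' − r; in other words, Γ_t and Ξ_t are geodesics both for d_g and for D_{f,g}. -/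
open scoped ENNReal

/-- A slice trajectory: a pair `(f,g)` of continuous functions on a common closed interval
`I` such that `d_f(s,t) = 0` implies `g(s) = g(t)`, with the prescribed behaviour when `I`
is unbounded below or above. -/
def IsSliceTrajectory (I : Set ℝ) (f g : ℝ → ℝ) : Prop :=
  IsClosed I ∧ I.OrdConnected ∧ I.Nonempty ∧
  ContinuousOn f I ∧ ContinuousOn g I ∧
  (∀ s ∈ I, ∀ t ∈ I, dOf f s t = 0 → g s = g t) ∧
  (¬ BddBelow I →
    Filter.Tendsto f (Filter.atBot ⊓ Filter.principal I) Filter.atTop ∧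
    ¬ BddBelow (g '' (I ∩ Set.Iic 0))) ∧
  (¬ BddAbove I →
    ¬ BddBelow (f '' (I ∩ Set.Ici 0)) ∧ ¬ BddBelow (g '' (I ∩ Set.Ici 0)))

/-- `Γ_t(r) = inf{s ∈ I : s ≥ t, g(s) = g(t) − r}`. -/
noncomputable def sliceGeo (I : Set ℝ) (g : ℝ → ℝ) (t r : ℝ) : ℝ :=
  sInf {s | s ∈ I ∧ t ≤ s ∧ g s = g t - r}

/-- `Ξ_t(r) = sup{s ∈ I : s ≤ t, g(s) = g(t) − r}`. -/
noncomputable def sliceShuttle (I : Set ℝ) (g : ℝ → ℝ) (t r : ℝ) : ℝ :=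
  sSup {s | s ∈ I ∧ s ≤ t ∧ g s = g t - r}

theorem abs_sub_le_dOf {I : Set ℝ} (hc : I.OrdConnected) {g : ℝ → ℝ}
    (hg : ContinuousOn g I) {s t : ℝ} (hs : s ∈ I) (ht : t ∈ I) : |g s - g t| ≤ dOf g s t := by
  have hsub : Set.Icc (min s t) (max s t) ⊆ I := hc.uIcc_subset hs ht
  have hb : BddBelow (g '' Set.Icc (min s t) (max s t)) :=
    (isCompact_Icc.image_of_continuousOn (hg.mono hsub)).bddBelow
  have h1 := csInf_le hb ⟨s, ⟨min_le_left _ _, le_max_left _ _⟩, rfl⟩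
  have h2 := csInf_le hb ⟨t, ⟨min_le_right _ _, le_max_right _ _⟩, rfl⟩
  unfold dOf
  rw [abs_le]
  constructor <;> linarith

theorem dOf_eq_sub_of_forall_le {g : ℝ → ℝ} {p q : ℝ} (h : ∀ v ∈ Set.uIcc p q, g q ≤ g v) :
    dOf g p q = g p - g q := by
  have hl : IsLeast (g '' Set.Icc (min p q) (max p q)) (g q) := by
    refine ⟨⟨q, ⟨min_le_right _ _, le_max_right _ _⟩, rfl⟩, ?_⟩
    rintro _ ⟨v, hv, rfl⟩
    exact h v hv
  unfold dOf
  rw [hl.csInf_eq]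
  ring

theorem ofReal_abs_sub_le_sum (g : ℝ → ℝ) (d : ℝ → ℝ → ℝ≥0∞) {n : ℕ} (a b : Fin (n + 1) → ℝ)
    (hd : ∀ i, ENNReal.ofReal |g (a i) - g (b i)| ≤ d (a i) (b i))
    (hR : ∀ i : Fin n, g (b i.castSucc) = g (a i.succ)) :
    ENNReal.ofReal |g (a 0) - g (b (Fin.last n))| ≤ ∑ i, d (a i) (b i) := by
  induction n with
  | zero => simpa using hd 0
  | succ n ih =>
    rw [Fin.sum_univ_castSucc]
    have h1 := ih (fun i => a i.castSucc) (fun i => b i.castSucc) (fun i => hd _)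
      (fun i => hR i.castSucc)
    have h2 := hd (Fin.last (n + 1))
    have h3 := hR (Fin.last n)
    rw [Fin.succ_last] at h3
    refine le_trans ?_ (add_le_add h1 h2)
    rw [← ENNReal.ofReal_add (abs_nonneg _) (abs_nonneg _)]
    apply ENNReal.ofReal_le_ofReal
    simp only [h3]
    exact abs_sub_le _ _ _

theorem sliceGeo_spec {I : Set ℝ} (hI : IsClosed I) (hc : I.OrdConnected) {g : ℝ → ℝ}
    (hg : ContinuousOn g I) {t r u : ℝ} (ht : t ∈ I) (hr : 0 ≤ r) (hu : u ∈ I) (htu : t ≤ u)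
    (hgu : g u ≤ g t - r) :
    sliceGeo I g t r ∈ I ∧ t ≤ sliceGeo I g t r ∧ sliceGeo I g t r ≤ u ∧
      g (sliceGeo I g t r) = g t - r ∧ ∀ v ∈ Set.Icc t (sliceGeo I g t r), g t - r ≤ g v := by
  set A : Set ℝ := {s | s ∈ I ∧ t ≤ s ∧ g s = g t - r} with hA
  have hp : sliceGeo I g t r = sInf A := rfl
  have hbdd : BddBelow A := ⟨t, fun s hs => hs.2.1⟩
  have hit : ∀ v ∈ I, t ≤ v → g v ≤ g t - r → ∃ w ∈ A, w ≤ v := by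
    intro v hv htv hgv
    obtain ⟨w, hw, hgw⟩ := intermediate_value_Icc' htv (hg.mono (hc.out ht hv))
      (show g t - r ∈ Set.Icc (g v) (g t) from ⟨hgv, by linarith⟩)
    exact ⟨w, ⟨hc.out ht hv hw, hw.1, hgw⟩, hw.2⟩
  have hclosed : IsClosed A := by
    have h1 : IsClosed (I ∩ g ⁻¹' {g t - r}) := hg.preimage_isClosed_of_isClosed hI isClosed_singleton
    convert h1.inter (isClosed_Ici (a := t)) using 1
    ext s
    simp only [hA, Set.mem_ofPred_eq, Set.mem_inter_iff, Set.mem_preimage, Set.mem_singleton_iff,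
      Set.mem_Ici]
    tauto
  obtain ⟨w, hw, hwu⟩ := hit u hu htu hgu
  obtain ⟨h1, h2, h3⟩ := hclosed.csInf_mem ⟨w, hw⟩ hbdd
  rw [hp]
  refine ⟨h1, h2, (csInf_le hbdd hw).trans hwu, h3, fun v hv => ?_⟩
  by_contra! hlt
  obtain ⟨z, hz, hzv⟩ := hit v (hc.out ht h1 hv) hv.1 hlt.le
  have hvp : v = sInf A := le_antisymm hv.2 ((csInf_le hbdd hz).trans hzv)
  rw [hvp, h3] at hlt
  exact lt_irrefl _ hlt

theorem sliceShuttle_eq_neg_sliceGeo (I : Set ℝ) (g : ℝ → ℝ) (t r : ℝ) :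
    sliceShuttle I g t r = -sliceGeo (-I) (fun x => g (-x)) (-t) r := by
  unfold sliceShuttle sliceGeo
  rw [Real.sInf_def, neg_neg]
  congr 1
  ext s
  simp

theorem sliceShuttle_spec {I : Set ℝ} (hI : IsClosed I) (hc : I.OrdConnected) {g : ℝ → ℝ}
    (hg : ContinuousOn g I) {t r u : ℝ} (ht : t ∈ I) (hr : 0 ≤ r) (hu : u ∈ I) (hut : u ≤ t)
    (hgu : g u ≤ g t - r) :
    sliceShuttle I g t r ∈ I ∧ sliceShuttle I g t r ≤ t ∧ u ≤ sliceShuttle I g t r ∧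
      g (sliceShuttle I g t r) = g t - r ∧
      ∀ v ∈ Set.Icc (sliceShuttle I g t r) t, g t - r ≤ g v := by
  have hc' : (-I).OrdConnected := ⟨fun x hx y hy z hz =>
    hc.out hy hx ⟨neg_le_neg hz.2, neg_le_neg hz.1⟩⟩
  have hg' : ContinuousOn (fun x => g (-x)) (-I) :=
    hg.comp continuous_neg.continuousOn (fun x hx => hx)
  obtain ⟨h1, h2, h3, h4, h5⟩ := sliceGeo_spec (I := -I) (hI.preimage continuous_neg) hc' hg'
    (t := -t) (r := r) (u := -u) (by simpa using ht) hr (by simpa using hu) (neg_le_neg hut)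
    (by simpa using hgu)
  rw [sliceShuttle_eq_neg_sliceGeo]
  simp only [neg_neg] at h4 h5
  refine ⟨h1, by linarith, by linarith, h4, fun v hv => ?_⟩
  simpa using h5 (-v) ⟨neg_le_neg hv.2, by linarith [hv.1]⟩

theorem exists_le_sub_of_le_sub_iInf {K : Set ℝ} {g : ℝ → ℝ} (hne : K.Nonempty)
    (hK : (IsCompact K ∧ ContinuousOn g K) ∨ ¬ BddBelow (g '' K)) {c r : ℝ}
    (hr : (r : EReal) ≤ (c : EReal) - ⨅ u ∈ K, (g u : EReal)) : ∃ u ∈ K, g u ≤ c - r := by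
  rcases hK with ⟨hK, hg⟩ | hK
  · obtain ⟨u, hu, hmin⟩ := hK.exists_isMinOn hne hg
    refine ⟨u, hu, ?_⟩
    have h1 : (g u : EReal) ≤ ⨅ u ∈ K, (g u : EReal) :=
      le_iInf₂ fun v hv => EReal.coe_le_coe_iff.2 (hmin hv)
    have h2 := hr.trans (EReal.sub_le_sub le_rfl h1)
    rw [← EReal.coe_sub, EReal.coe_le_coe_iff] at h2
    linarith
  · by_contra! h
    exact hK ⟨c - r, by rintro _ ⟨u, hu, rfl⟩; exact (h u hu).le⟩

theorem isCompact_or_not_bddBelow_image {I J K : Set ℝ} (hI : IsClosed I) {g : ℝ → ℝ}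
    (hg : ContinuousOn g I) (hK : IsClosed K) (hb : BddBelow (I ∩ K) ∧ BddAbove (I ∩ K) ∨
      ¬ BddBelow (g '' (I ∩ J))) {a b : ℝ} (hJK : J ⊆ K ∪ Set.Icc a b) :
    (IsCompact (I ∩ K) ∧ ContinuousOn g (I ∩ K)) ∨ ¬ BddBelow (g '' (I ∩ K)) := by
  rcases hb with ⟨h1, h2⟩ | hb
  · exact .inl ⟨Metric.isCompact_of_isClosed_isBounded (hI.inter hK)
      (isBounded_iff_bddBelow_bddAbove.2 ⟨h1, h2⟩), hg.mono Set.inter_subset_left⟩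
  · refine .inr fun hbdd => hb ?_
    have hcomp : BddBelow (g '' (I ∩ Set.Icc a b)) :=
      ((isCompact_Icc.inter_left hI).image_of_continuousOn
        (hg.mono Set.inter_subset_left)).bddBelow
    refine (hbdd.union hcomp).mono ?_
    rw [← Set.image_union, ← Set.inter_union_distrib_left]
    exact Set.image_mono (Set.inter_subset_inter_right _ hJK)

/-- in a slice trajectory, `|g(s) − g(t)| ≤ D_{f,g}(s,t) ≤ d_g(s,t)`, and the
paths `Γ_t`, `Ξ_t` are geodesics both for `d_g` and for `D_{f,g}`. -/
theorem slice_geodesics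
    (I : Set ℝ) (f g : ℝ → ℝ) (h : IsSliceTrajectory I f g) :
    (∀ s ∈ I, ∀ t ∈ I,
      ENNReal.ofReal |g s - g t| ≤ Dquot f g I s t ∧
      Dquot f g I s t ≤ ENNReal.ofReal (dOf g s t)) ∧
    (∀ t ∈ I, ∀ r r' : ℝ, 0 ≤ r → r ≤ r' →
      ((r' : EReal) ≤ (g t : EReal) - ⨅ u ∈ I ∩ Set.Ici t, (g u : EReal)) →
      dOf g (sliceGeo I g t r) (sliceGeo I g t r') = r' - r ∧
      Dquot f g I (sliceGeo I g t r) (sliceGeo I g t r') = ENNReal.ofReal (r' - r)) ∧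
    (∀ t ∈ I, ∀ r r' : ℝ, 0 ≤ r → r ≤ r' →
      ((r' : EReal) ≤ (g t : EReal) - ⨅ u ∈ I ∩ Set.Iic t, (g u : EReal)) →
      dOf g (sliceShuttle I g t r) (sliceShuttle I g t r') = r' - r ∧
      Dquot f g I (sliceShuttle I g t r) (sliceShuttle I g t r') =
        ENNReal.ofReal (r' - r)) := by
  obtain ⟨hI, hc, -, -, hg, hfg, hbot, htop⟩ := h
  have bounds : ∀ s ∈ I, ∀ t ∈ I,
      ENNReal.ofReal |g s - g t| ≤ Dquot f g I s t ∧
      Dquot f g I s t ≤ ENNReal.ofReal (dOf g s t) := by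
    intro s hs t ht
    refine ⟨?_, quotDistOn_le _ _ hs ht⟩
    unfold Dquot quotDistOn
    simp only [le_iInf_iff]
    rintro n a b ha hb rfl rfl hR
    exact ofReal_abs_sub_le_sum g (fun s t => ENNReal.ofReal (dOf g s t)) a b
      (fun i => ENNReal.ofReal_le_ofReal (abs_sub_le_dOf hc hg (ha i) (hb i)))
      (fun i => hfg _ (hb _) _ (ha _) (hR i))
  have geodesic : ∀ p ∈ I, ∀ q ∈ I, ∀ c r r' : ℝ, r ≤ r' → g p = c - r → g q = c - r' →
      (∀ v ∈ Set.uIcc p q, c - r' ≤ g v) →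
      dOf g p q = r' - r ∧ Dquot f g I p q = ENNReal.ofReal (r' - r) := by
    intro p hp q hq c r r' hrr hgp hgq hv
    have hd : dOf g p q = r' - r := by
      rw [dOf_eq_sub_of_forall_le (by rwa [hgq]), hgp, hgq]
      ring
    obtain ⟨h1, h2⟩ := bounds p hp q hq
    refine ⟨hd, le_antisymm (hd ▸ h2) ?_⟩
    rwa [hgp, hgq, show c - r - (c - r') = r' - r by ring,
      abs_of_nonneg (sub_nonneg.2 hrr)] at h1
  refine ⟨bounds, fun t ht r r' hr hrr hinf => ?_, fun t ht r r' hr hrr hinf => ?_⟩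
  · obtain ⟨u, ⟨hu, htu⟩, hgu⟩ := exists_le_sub_of_le_sub_iInf
      (K := I ∩ Set.Ici t) ⟨t, ht, Set.self_mem_Ici⟩
      (isCompact_or_not_bddBelow_image (J := Set.Ici 0) (a := 0) (b := t) hI hg isClosed_Ici
        (by
          by_cases hI' : BddAbove I
          · exact .inl ⟨bddBelow_Ici.mono Set.inter_subset_right,
              hI'.mono Set.inter_subset_left⟩
          · exact .inr (htop hI').2)
        (fun x hx => (le_total t x).imp id fun h => ⟨hx, h⟩)) hinf
    obtain ⟨hq, htq, -, hgq, hvq⟩ := sliceGeo_spec hI hc hg ht (hr.trans hrr) hu htu hgu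
    obtain ⟨hp, htp, hpq, hgp, -⟩ := sliceGeo_spec hI hc hg ht hr hq htq (by linarith)
    refine geodesic _ hp _ hq _ _ _ hrr hgp hgq fun v hv => ?_
    rw [Set.uIcc_of_le hpq] at hv
    exact hvq v ⟨htp.trans hv.1, hv.2⟩
  · obtain ⟨u, ⟨hu, hut⟩, hgu⟩ := exists_le_sub_of_le_sub_iInf
      (K := I ∩ Set.Iic t) ⟨t, ht, Set.self_mem_Iic⟩
      (isCompact_or_not_bddBelow_image (J := Set.Iic 0) (a := t) (b := 0) hI hg isClosed_Iic
        (by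
          by_cases hI' : BddBelow I
          · exact .inl ⟨hI'.mono Set.inter_subset_left,
              bddAbove_Iic.mono Set.inter_subset_right⟩
          · exact .inr (hbot hI').2)
        (fun x hx => (le_total x t).imp id fun h => ⟨h, hx⟩)) hinf
    obtain ⟨hq, hqt, -, hgq, hvq⟩ := sliceShuttle_spec hI hc hg ht (hr.trans hrr) hu hut hgu
    obtain ⟨hp, hpt, hqp, hgp, -⟩ := sliceShuttle_spec hI hc hg ht hr hq hqt (by linarith)
    refine geodesic _ hp _ hq _ _ _ hrr hgp hgq fun v hv => ?_
    rw [Set.uIcc_of_ge hqp] at hv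
    exact hvq v ⟨hv.1, hv.2.trans hpt⟩
end

section
/- Let X : ℝ → ℝ be continuous with X(0) = 0. Set X̲_t = inf{X_u : u ∈ [0∧t, 0∨t]} and Π_t = X_t − 2·X̲_t. Then for all real 0 ≤ s ≤ t: inf{Π_u : u ∈ [s,t]} = inf{X_u : u ∈ [s,t]} − X̲_s − X̲_t. If moreover inf{X_u : u ≥ 0} = −∞, then for all s ≥ 0: inf{Π_u : u ≥ s} = −X̲_s. -/
/-- `X̲_t`: the infimum of `X` over the closed interval with endpoints `0` and `t`. -/
noncomputable def lowX (X : ℝ → ℝ) (t : ℝ) : ℝ :=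
  sInf (X '' Set.uIcc 0 t)

/-- The two-sided Pitman transform `Π = X − 2X̲` of `X`. -/
noncomputable def Pit (X : ℝ → ℝ) (t : ℝ) : ℝ :=
  X t - 2 * lowX X t

/-- For `t ≥ 0`, `lowX X t` is the attained minimum of `X` over `[0, t]`. -/
theorem isLeast_lowX {X : ℝ → ℝ} (hX : Continuous X) {t : ℝ} (ht : 0 ≤ t) :
    IsLeast (X '' Set.Icc 0 t) (lowX X t) := by
  rw [lowX, Set.uIcc_of_le ht]
  exact (isCompact_Icc.image hX).isLeast_sInf ((Set.nonempty_Icc.2 ht).image X)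

theorem lowX_le {X : ℝ → ℝ} (hX : Continuous X) {u t : ℝ} (hu : 0 ≤ u) (hut : u ≤ t) :
    lowX X t ≤ X u :=
  (isLeast_lowX hX (hu.trans hut)).2 ⟨u, ⟨hu, hut⟩, rfl⟩

theorem lowX_anti {X : ℝ → ℝ} (hX : Continuous X) {s t : ℝ} (hs : 0 ≤ s) (hst : s ≤ t) :
    lowX X t ≤ lowX X s := by
  obtain ⟨v, hv, hve⟩ := (isLeast_lowX hX hs).1
  exact hve ▸ lowX_le hX hv.1 (hv.2.trans hst)

/-- If `X` stays above `lowX X s` on `[s, t]`, the running infimum does not change there. -/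
theorem lowX_eq_of_le {X : ℝ → ℝ} (hX : Continuous X) {s t : ℝ} (hs : 0 ≤ s) (hst : s ≤ t)
    (h : ∀ v ∈ Set.Icc s t, lowX X s ≤ X v) : lowX X t = lowX X s := by
  refine le_antisymm (lowX_anti hX hs hst) ?_
  obtain ⟨v, hv, hve⟩ := (isLeast_lowX hX (hs.trans hst)).1
  rw [← hve]
  rcases le_total v s with hvs | hsv
  · exact lowX_le hX hv.1 hvs
  · exact h v ⟨hsv, hv.2⟩

theorem neg_lowX_le_Pit {X : ℝ → ℝ} (hX : Continuous X) {s u : ℝ} (hs : 0 ≤ s) (hsu : s ≤ u) :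
    -lowX X s ≤ Pit X u := by
  have h1 := lowX_anti hX hs hsu
  have h2 := lowX_le hX (hs.trans hsu) le_rfl
  rw [Pit]
  linarith

/-- If `X` goes below `lowX X s` at some time `t ≥ s`, then at the first time after `s` at which
`X` reaches the level `lowX X s`, the Pitman transform equals `-lowX X s`. -/
theorem exists_Pit_eq_neg_lowX {X : ℝ → ℝ} (hX : Continuous X) {s t : ℝ} (hs : 0 ≤ s)
    (hst : s ≤ t) (h : X t < lowX X s) : ∃ u ∈ Set.Icc s t, Pit X u = -lowX X s := by
  have hcomp : IsCompact (Set.Icc s t ∩ {u | X u ≤ lowX X s}) :=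
    isCompact_Icc.inter_right (isClosed_le hX continuous_const)
  obtain ⟨u, ⟨hu, hXu⟩, hmin⟩ := hcomp.exists_isLeast ⟨t, ⟨hst, le_rfl⟩, h.le⟩
  have hXu' : X u = lowX X s := by
    obtain ⟨v, hv, hve⟩ := intermediate_value_Icc' hu.1 hX.continuousOn
      ⟨hXu, lowX_le hX hs le_rfl⟩
    have huv : u ≤ v := hmin ⟨⟨hv.1, hv.2.trans hu.2⟩, hve.le⟩
    rwa [le_antisymm huv hv.2]
  have hlow : lowX X u = lowX X s := by
    refine lowX_eq_of_le hX hs hu.1 fun v hv => ?_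
    by_contra! hlt
    have huv : u ≤ v := hmin ⟨⟨hv.1, hv.2.trans hu.2⟩, hlt.le⟩
    rw [← le_antisymm huv hv.2, hXu'] at hlt
    exact hlt.false
  refine ⟨u, hu, ?_⟩
  rw [Pit, hXu', hlow]
  ring

/-- for `0 ≤ s ≤ t`, `inf_{[s,t]} Π = inf_{[s,t]} X − X̲_s − X̲_t`; and if
`inf_{u ≥ 0} X_u = −∞, then for `s ≥ 0`, `inf_{u ≥ s} Π_u = −X̲_s`. -/
theorem pitman_infima (X : ℝ → ℝ) (hX : Continuous X) (hX0 : X 0 = 0) :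
    (∀ s t : ℝ, 0 ≤ s → s ≤ t →
      sInf (Pit X '' Set.Icc s t) =
        sInf (X '' Set.Icc s t) - lowX X s - lowX X t) ∧
    (¬ BddBelow (X '' Set.Ici 0) → ∀ s : ℝ, 0 ≤ s →
      sInf (Pit X '' Set.Ici s) = - lowX X s) := by
  refine ⟨fun s t hs hst => ?_, fun hunb s hs => ?_⟩
  · obtain ⟨⟨w, hw, hwe⟩, hlb⟩ := (isCompact_Icc.image hX).isLeast_sInf
      ((Set.nonempty_Icc.2 hst).image X)
    set m := sInf (X '' Set.Icc s t)
    have hm : ∀ v ∈ Set.Icc s t, m ≤ X v := fun v hv => hlb ⟨v, hv, rfl⟩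
    apply IsLeast.csInf_eq
    rcases le_or_gt (lowX X s) m with h | h
    · have hlow : ∀ u ∈ Set.Icc s t, lowX X u = lowX X s := fun u hu =>
        lowX_eq_of_le hX hs hu.1 fun v hv => h.trans (hm v ⟨hv.1, hv.2.trans hu.2⟩)
      rw [hlow t ⟨hst, le_rfl⟩]
      refine ⟨⟨w, hw, ?_⟩, ?_⟩
      · rw [Pit, hwe, hlow w hw]
        ring
      · rintro _ ⟨u, hu, rfl⟩
        rw [Pit, hlow u hu]
        linarith [hm u hu]
    · have hlow : lowX X t = m := by
        refine le_antisymm (hwe ▸ lowX_le hX (hs.trans hw.1) hw.2) ?_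
        obtain ⟨v, hv, hve⟩ := (isLeast_lowX hX (hs.trans hst)).1
        rw [← hve]
        rcases le_total v s with hvs | hsv
        · exact h.le.trans (lowX_le hX hv.1 hvs)
        · exact hm v ⟨hsv, hv.2⟩
      have hval : m - lowX X s - lowX X t = -lowX X s := by
        rw [hlow]
        ring
      rw [hval]
      obtain ⟨u, hu, hue⟩ := exists_Pit_eq_neg_lowX hX hs hw.1 (hwe ▸ h)
      refine ⟨⟨u, ⟨hu.1, hu.2.trans hw.2⟩, hue⟩, ?_⟩
      rintro _ ⟨v, hv, rfl⟩
      exact neg_lowX_le_Pit hX hs hv.1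
  · obtain ⟨_, ⟨t, ht, rfl⟩, hlt⟩ := not_bddBelow_iff.1 hunb (lowX X s)
    have hst : s ≤ t := by
      by_contra! hts
      exact (lowX_le hX ht hts.le).not_gt hlt
    obtain ⟨u, hu, hue⟩ := exists_Pit_eq_neg_lowX hX hs hst hlt
    apply IsLeast.csInf_eq
    refine ⟨⟨u, hu.1, hue⟩, ?_⟩
    rintro _ ⟨v, hv, rfl⟩
    exact neg_lowX_le_Pit hX hs hv
end
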